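/- (Gurevich) For every integer d ≥ 2 there exists a ℂ-linear subspace V of the space C(ℝ^d,ℂ) of continuous complex-valued functions on ℝ^d, invariant under all translations f ↦ f(·+g) and closed in the topology of uniform convergence on compact sets (the compact-open topology), such that the ℂ-linear span of the set of exponential monomials belonging to V is not dense in V. -/

import Mathlib

open scoped BigOperators

namespace Gurevich
open Complex MeasureTheory Filter Topology Set

section Utilities

/-- Holomorphic dependence of an integral on a complex parameter. -/
theorem differentiable_integral_param {α : Type*} [MeasurableSpace α] {μ : Measure α}
    {f : α → ℂ → ℂ} (hmeas : ∀ z, AEStronglyMeasurable (fun s => f s z) μ)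
    (hdiff : ∀ s, Differentiable ℂ (f s))
    (hdom : ∀ R : ℝ, ∃ g : α → ℝ, Integrable g μ ∧ ∀ s z, ‖z‖ ≤ R → ‖f s z‖ ≤ g s) :
    Differentiable ℂ (fun z => ∫ s, f s z ∂μ) := by
  intro z₀
  obtain ⟨g, hg, hfg⟩ := hdom (‖z₀‖ + 2)
  have hder : ∀ s, ∀ z ∈ Metric.ball z₀ 1, ‖deriv (f s) z‖ ≤ g s := by
    intro s z hz
    have := norm_deriv_le_of_forall_mem_sphere_norm_le (f := f s) (c := z) (C := g s)
      zero_lt_one (hdiff s).diffContOnCl (fun w hw => hfg s w ?_)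
    · simpa using this
    · rw [mem_ball_iff_norm] at hz
      rw [mem_sphere_iff_norm] at hw
      calc ‖w‖ = ‖(w - z) + (z - z₀) + z₀‖ := by congr 1; ring
        _ ≤ ‖w - z‖ + ‖z - z₀‖ + ‖z₀‖ := norm_add₃_le
        _ ≤ ‖z₀‖ + 2 := by linarith
  have hmeas' : AEStronglyMeasurable (fun s => deriv (f s) z₀) μ := by
    have hseq : Tendsto (fun n : ℕ => (1 / ((n : ℂ) + 1))) atTop (𝓝[≠] 0) := by
      rw [tendsto_nhdsWithin_iff]
      refine ⟨tendsto_one_div_add_atTop_nhds_zero_nat, Eventually.of_forall fun n => ?_⟩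
      simpa using Nat.cast_add_one_ne_zero n
    refine aestronglyMeasurable_of_tendsto_ae (u := atTop)
      (f := fun (n : ℕ) s => (1 / ((n : ℂ) + 1))⁻¹ • (f s (z₀ + 1 / ((n : ℂ) + 1)) - f s z₀))
      (fun n => ((hmeas (z₀ + 1 / ((n : ℂ) + 1))).sub (hmeas z₀)).const_smul
        (1 / ((n : ℂ) + 1))⁻¹) (Eventually.of_forall fun s => ?_)
    exact ((hdiff s z₀).hasDerivAt.tendsto_slope_zero).comp hseq
  refine (hasDerivAt_integral_of_dominated_loc_of_deriv_le (F := fun z s => f s z)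
    (F' := fun z s => deriv (f s) z) (bound := g) (Metric.ball_mem_nhds z₀ zero_lt_one)
    (Eventually.of_forall hmeas) ?_ hmeas' (Eventually.of_forall hder) hg
    (Eventually.of_forall fun s z _ => (hdiff s z).hasDerivAt)).2.differentiableAt
  exact hg.mono' (hmeas _) (Eventually.of_forall fun s => hfg s z₀ (by linarith))

/-- A continuous integrable function on the line is determined by its Fourier transform. -/
theorem eq_zero_of_forall_integral_exp_eq_zero {f : ℝ → ℂ} (hf : Continuous f)
    (hi : Integrable f) (h : ∀ ξ : ℝ, ∫ t : ℝ, exp (ξ * t * I) * f t = 0) (t : ℝ) : f t = 0 := by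
  have h0 : FourierTransform.fourier f = 0 := by
    ext w
    rw [Real.fourier_eq']
    refine Eq.trans ?_ (h (-2 * Real.pi * w))
    refine integral_congr_ae (Eventually.of_forall fun v => ?_)
    simp only [smul_eq_mul, RCLike.inner_apply, conj_trivial]
    push_cast
    ring_nf
  have := hf.fourierInv_fourier_eq hi (by rw [h0]; exact integrable_zero _ _ _)
  rw [h0] at this
  rw [← this, Real.fourierInv_eq']
  simp

theorem integrable_const_div_one_add_sq (K : ℝ) :
    Integrable (fun t : ℝ => K / (1 + t ^ 2)) := by
  simpa [div_eq_mul_inv] using integrable_inv_one_add_sq.const_mul K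

theorem continuous_vertical {f : ℂ → ℂ} {a : ℝ} {s : Set ℂ} (hf : ContinuousOn f s)
    (h : ∀ t : ℝ, (a : ℂ) + t * I ∈ s) : Continuous fun t : ℝ => f (a + t * I) :=
  hf.comp_continuous (by fun_prop) h

theorem tendsto_const_div_one_add_sq (K : ℝ) :
    Tendsto (fun T : ℝ => K / (1 + T ^ 2)) atTop (𝓝 0) :=
  Tendsto.const_div_atTop (tendsto_atTop_add_const_left _ _ (tendsto_pow_atTop two_ne_zero)) K

/-- Vertical line integrals may be shifted across a strip of holomorphy. -/
theorem integral_vertical_eq {f : ℂ → ℂ} {a b K : ℝ} (hab : a ≤ b)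
    (hf : DifferentiableOn ℂ f {z | a ≤ z.re ∧ z.re ≤ b})
    (hK : ∀ z : ℂ, a ≤ z.re → z.re ≤ b → ‖f z‖ ≤ K / (1 + z.im ^ 2)) :
    ∫ t : ℝ, f (a + t * I) = ∫ t : ℝ, f (b + t * I) := by
  have hint : ∀ c : ℝ, a ≤ c → c ≤ b → Integrable fun t : ℝ => f (c + t * I) := by
    intro c hac hcb
    refine (integrable_const_div_one_add_sq K).mono'
      (continuous_vertical hf.continuousOn ?_).aestronglyMeasurable
      (Eventually.of_forall fun t => ?_)
    · intro t; simp [hac, hcb]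
    · simpa using hK (c + t * I) (by simpa using hac) (by simpa using hcb)
  have hrect : ∀ T : ℝ, ((∫ x : ℝ in a..b, f (x + (-T : ℝ) * I))
      - ∫ x : ℝ in a..b, f (x + T * I)) + I • (∫ t : ℝ in (-T)..T, f (b + t * I))
      - I • (∫ t : ℝ in (-T)..T, f (a + t * I)) = 0 := by
    intro T
    have := integral_boundary_rect_eq_zero_of_differentiableOn f (⟨a, -T⟩ : ℂ) (⟨b, T⟩ : ℂ)
      (hf.mono fun z hz => ?_)
    · simpa using this
    · have := hz.1
      rw [uIcc_of_le hab] at this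
      exact this
  have hedge : ∀ σ : ℝ, σ ^ 2 = 1 →
      Tendsto (fun T : ℝ => ∫ x : ℝ in a..b, f (x + ((σ * T : ℝ) : ℂ) * I)) atTop (𝓝 0) := by
    intro σ hσ
    have hz : Tendsto (fun T : ℝ => K / (1 + T ^ 2) * |b - a|) atTop (𝓝 0) := by
      simpa using (tendsto_const_div_one_add_sq K).mul_const |b - a|
    refine squeeze_zero_norm (fun T => ?_) hz
    refine intervalIntegral.norm_integral_le_of_norm_le_const fun x hx => ?_
    rw [uIoc_of_le hab] at hx
    have := hK (x + ((σ * T : ℝ) : ℂ) * I) (by simpa using hx.1.le) (by simpa using hx.2)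
    have h2 : (σ * T) ^ 2 = T ^ 2 := by rw [mul_pow, hσ, one_mul]
    simpa [mul_pow, hσ] using this
  have hlim := (((hedge (-1) (by norm_num)).sub (hedge 1 (by norm_num))).add
    ((intervalIntegral_tendsto_integral (hint b hab le_rfl)
      tendsto_neg_atTop_atBot tendsto_id).const_smul I)).sub
    ((intervalIntegral_tendsto_integral (hint a le_rfl hab)
      tendsto_neg_atTop_atBot tendsto_id).const_smul I)
  have h0 := tendsto_nhds_unique (hlim.congr fun T => by simpa using hrect T) tendsto_const_nhds
  simp only [sub_zero, zero_add, smul_eq_mul] at h0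
  exact (mul_left_cancel₀ I_ne_zero (sub_eq_zero.mp h0)).symm

/-- A vertical line integral vanishes when the integrand extends with decay to the right. -/
theorem integral_vertical_eq_zero {f : ℂ → ℂ} {a K : ℝ} (ha : 0 < a)
    (hf : DifferentiableOn ℂ f {z | a ≤ z.re})
    (hK : ∀ z : ℂ, a ≤ z.re → ‖f z‖ ≤ K / (z.re * (1 + z.im ^ 2))) :
    ∫ t : ℝ, f (a + t * I) = 0 := by
  have hK0 : 0 ≤ K := by
    have := (norm_nonneg _).trans (hK a (by simp))
    simp only [ofReal_re, ofReal_im] at this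
    by_contra hneg
    push Not at hneg
    have h2 : K / (a * (1 + 0 ^ 2)) < 0 := div_neg_of_neg_of_pos hneg (by positivity)
    linarith
  have hshift : ∀ b : ℝ, a ≤ b → ∫ t : ℝ, f (a + t * I) = ∫ t : ℝ, f (b + t * I) := by
    intro b hab
    refine integral_vertical_eq (K := K / a) hab (hf.mono fun z hz => hz.1) fun z hz _ => ?_
    refine (hK z hz).trans ?_
    rw [div_div]
    gcongr
  have hle : ∀ᶠ b : ℝ in atTop, ‖∫ t : ℝ, f (a + t * I)‖ ≤ (∫ t : ℝ, K / (1 + t ^ 2)) / b := by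
    filter_upwards [eventually_ge_atTop a] with b hb
    rw [hshift b hb, ← integral_div]
    refine norm_integral_le_of_norm_le ((integrable_const_div_one_add_sq K).div_const b)
      (Eventually.of_forall fun t => ?_)
    have := hK (b + t * I) (by simpa using hb)
    rw [div_div, mul_comm (1 + t ^ 2)]
    simpa using this
  have := ge_of_tendsto (tendsto_const_nhds.div_atTop tendsto_id) hle
  exact norm_le_zero_iff.mp this

/-- Taylor coefficients at the origin. -/
noncomputable def coeff (f : ℂ → ℂ) (m : ℕ) : ℂ := (m.factorial : ℂ)⁻¹ * iteratedDeriv m f 0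

theorem hasSum_coeff {f : ℂ → ℂ} (hf : Differentiable ℂ f) (z : ℂ) :
    HasSum (fun m => coeff f m * z ^ m) (f z) := by
  refine (hasSum_taylorSeries_of_entire hf 0 z).congr_fun fun m => ?_
  simp [coeff]; ring

theorem norm_coeff_le {f : ℂ → ℂ} {M : ℝ} (hf : Differentiable ℂ f)
    (hM : ∀ z, ‖f z‖ ≤ M * Real.exp (‖z‖ ^ (2 / 3 : ℝ))) (m : ℕ) :
    ‖coeff f m‖ ≤ M * Real.exp 1 ^ m / (m.factorial : ℝ) ^ (3 / 2 : ℝ) := by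
  have hM0 : 0 ≤ M := by
    have := (norm_nonneg _).trans (hM 0)
    exact nonneg_of_mul_nonneg_left this (Real.exp_pos _)
  have hfac : (0 : ℝ) < (m.factorial : ℝ) := by positivity
  rcases Nat.eq_zero_or_pos m with rfl | hm
  · simpa [coeff] using hM 0
  have hm0 : (0 : ℝ) < m := by exact_mod_cast hm
  set r : ℝ := (m : ℝ) ^ (3 / 2 : ℝ) with hr
  have hr0 : 0 < r := by positivity
  have hr2 : r ^ (2 / 3 : ℝ) = m := by
    rw [hr, ← Real.rpow_mul hm0.le]; norm_num
  have h1 := norm_iteratedDeriv_le_of_forall_mem_sphere_norm_le (f := f) (c := 0)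
    (C := M * Real.exp m) m hr0 hf.diffContOnCl (fun z hz => by
      have := hM z
      rw [mem_sphere_zero_iff_norm] at hz
      rwa [hz, hr2] at this)
  rw [coeff, norm_mul, norm_inv, norm_natCast]
  calc ((m.factorial : ℝ))⁻¹ * ‖iteratedDeriv m f 0‖
      ≤ (m.factorial : ℝ)⁻¹ * (m.factorial * (M * Real.exp m) / r ^ m) := by gcongr
    _ = M * Real.exp 1 ^ m / r ^ m := by
        rw [← Real.exp_nat_mul, mul_one]; field_simp
    _ ≤ _ := by
        gcongr
        rw [hr, ← Real.rpow_natCast, ← Real.rpow_mul hm0.le, mul_comm, Real.rpow_mul hm0.le,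
          Real.rpow_natCast]
        gcongr
        exact_mod_cast Nat.factorial_le_pow m

end Utilities

section Gamma

/-- A one-sided Gaussian transform, bounded on the right half-plane. -/
noncomputable def halfGauss (y : ℂ) : ℂ := ∫ s in Ioi (0 : ℝ), exp (-(s : ℂ) ^ 2 - 2 * s * y)

theorem norm_halfGauss_integrand (y : ℂ) (s : ℝ) :
    ‖exp (-(s : ℂ) ^ 2 - 2 * s * y)‖ = Real.exp (-s ^ 2 - 2 * s * y.re) := by
  rw [norm_exp]
  congr 1
  simp [pow_two]

theorem integrable_halfGauss_integrand (y : ℂ) :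
    Integrable fun s : ℝ => exp (-(s : ℂ) ^ 2 - 2 * s * y) := by
  refine (integrable_cexp_quadratic (b := 1) (by simp) (-2 * y) 0).congr
    (Eventually.of_forall fun s => ?_)
  simp only
  congr 1; ring

theorem differentiable_halfGauss : Differentiable ℂ halfGauss := by
  refine differentiable_integral_param (fun z => ?_) (fun s => by fun_prop) fun R => ?_
  · exact (integrable_halfGauss_integrand z).aestronglyMeasurable.restrict
  · refine ⟨fun s => ‖exp (-(s : ℂ) ^ 2 - 2 * s * (-R : ℂ))‖ +
      ‖exp (-(s : ℂ) ^ 2 - 2 * s * (R : ℂ))‖, ((integrable_halfGauss_integrand _).norm.add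
      (integrable_halfGauss_integrand _).norm).restrict, fun s z hz => ?_⟩
    simp only [norm_halfGauss_integrand]
    have hz' := abs_le.mp ((abs_re_le_norm z).trans hz)
    rcases le_total 0 s with hs | hs
    · refine le_add_of_le_of_nonneg ?_ (Real.exp_pos _).le
      rw [Real.exp_le_exp]
      have := mul_le_mul_of_nonneg_left hz'.1 hs
      simp only [neg_re, ofReal_re]
      linarith
    · refine le_add_of_nonneg_of_le (Real.exp_pos _).le ?_
      rw [Real.exp_le_exp]
      have := mul_le_mul_of_nonpos_left hz'.2 hs
      simp only [ofReal_re]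
      linarith

theorem norm_halfGauss_le_one {y : ℂ} (hy : 0 ≤ y.re) : ‖halfGauss y‖ ≤ 1 := by
  have h1 : ‖halfGauss y‖ ≤ ∫ s in Ioi (0 : ℝ), Real.exp (-1 * s ^ 2) := by
    refine norm_integral_le_of_norm_le (integrable_exp_neg_mul_sq one_pos).restrict ?_
    filter_upwards [self_mem_ae_restrict measurableSet_Ioi] with s hs
    rw [norm_halfGauss_integrand, Real.exp_le_exp]
    have : 0 ≤ s * y.re := mul_nonneg (le_of_lt hs) hy
    linarith
  refine h1.trans ?_
  rw [integral_gaussian_Ioi]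
  have : √(Real.pi / 1) ≤ 2 := by
    rw [Real.sqrt_le_left (by norm_num)]
    linarith [Real.pi_le_four]
  linarith

theorem halfGauss_add_halfGauss_neg (y : ℂ) :
    halfGauss y + halfGauss (-y) = √Real.pi * exp (y ^ 2) := by
  have h1 : halfGauss (-y) = ∫ s in Iic (0 : ℝ), exp (-(s : ℂ) ^ 2 - 2 * s * y) := by
    have := integral_comp_neg_Ioi 0 (fun s : ℝ => exp (-(s : ℂ) ^ 2 - 2 * s * y))
    rw [neg_zero] at this
    rw [← this, halfGauss]
    congr 1
    ext s
    push_cast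
    congr 1; ring
  rw [h1, halfGauss, add_comm, intervalIntegral.integral_Iic_add_Ioi
    (integrable_halfGauss_integrand y).integrableOn (integrable_halfGauss_integrand y).integrableOn]
  have := integral_cexp_quadratic (b := -1) (by simp) (-2 * y) 0
  simp only [neg_neg, div_one] at this
  rw [Real.sqrt_eq_rpow, ofReal_cpow Real.pi_pos.le]
  push_cast
  refine Eq.trans (integral_congr_ae (Eventually.of_forall fun s => ?_)) (this.trans ?_)
  · simp only
    congr 1; ring
  · congr 2; ring

theorem sqrt_pi_le_two : √Real.pi ≤ 2 := by
  rw [Real.sqrt_le_left (by norm_num)]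
  linarith [Real.pi_le_four]

theorem norm_halfGauss_le (y : ℂ) : ‖halfGauss y‖ ≤ 1 + 2 * Real.exp (y ^ 2).re := by
  rcases le_total 0 y.re with hy | hy
  · have := norm_halfGauss_le_one hy
    have := Real.exp_pos (y ^ 2).re
    linarith
  · have h := eq_sub_of_add_eq (halfGauss_add_halfGauss_neg y)
    rw [h]
    refine (norm_sub_le _ _).trans ?_
    have h1 := norm_halfGauss_le_one (y := -y) (by simpa using hy)
    rw [norm_mul, norm_exp, norm_real, Real.norm_of_nonneg (Real.sqrt_nonneg _)]
    have := mul_le_mul_of_nonneg_right sqrt_pi_le_two (Real.exp_pos (y ^ 2).re).le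
    linarith

theorem norm_halfGauss_le_three {y : ℂ} (hy : (y ^ 2).re ≤ 0) : ‖halfGauss y‖ ≤ 3 := by
  have := norm_halfGauss_le y
  have := Real.exp_le_one_iff.mpr hy
  linarith

/-- A primitive cube root of unity. -/
noncomputable def cubeRoot : ℂ := ⟨-1 / 2, √3 / 2⟩

theorem cubeRoot_sq : cubeRoot ^ 2 = ⟨-1 / 2, -(√3 / 2)⟩ := by
  have h3 : √3 * √3 = 3 := Real.mul_self_sqrt (by norm_num)
  apply Complex.ext
  · simp only [cubeRoot, pow_two, mul_re]
    linarith
  · simp only [cubeRoot, pow_two, mul_im]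
    ring

theorem cubeRoot_sq_add : cubeRoot ^ 2 + cubeRoot + 1 = 0 := by
  rw [cubeRoot_sq, cubeRoot]
  apply Complex.ext <;> simp

theorem cubeRoot_pow_three : cubeRoot ^ 3 = 1 := by
  linear_combination (cubeRoot - 1) * cubeRoot_sq_add

theorem norm_cubeRoot : ‖cubeRoot‖ = 1 := by
  have := congrArg norm cubeRoot_pow_three
  rw [norm_pow, norm_one] at this
  exact (pow_eq_one_iff_of_nonneg (norm_nonneg _) (by norm_num)).mp this

/-- The symmetrisation of `halfGauss` over cube roots of unity. -/
noncomputable def symGauss (y : ℂ) : ℂ :=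
  halfGauss y + halfGauss (cubeRoot * y) + halfGauss (cubeRoot ^ 2 * y)

theorem differentiable_symGauss : Differentiable ℂ symGauss := by
  have := differentiable_halfGauss
  unfold symGauss
  fun_prop

theorem symGauss_cubeRoot_mul (y : ℂ) : symGauss (cubeRoot * y) = symGauss y := by
  have h1 : cubeRoot * (cubeRoot * y) = cubeRoot ^ 2 * y := by ring
  have h2 : cubeRoot ^ 2 * (cubeRoot * y) = y := by
    linear_combination y * cubeRoot_pow_three
  rw [symGauss, symGauss, h1, h2]
  ring

theorem symGauss_eq_of_pow_three_eq {y z : ℂ} (h : y ^ 3 = z ^ 3) : symGauss y = symGauss z := by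
  have hfac : (y - z) * ((y - cubeRoot * z) * (y - cubeRoot * (cubeRoot * z))) = 0 := by
    linear_combination h + (-y ^ 2 * z + cubeRoot * y * z ^ 2 - (cubeRoot - 1) * z ^ 3) *
      cubeRoot_sq_add
  rcases mul_eq_zero.mp hfac with h | h
  · rw [sub_eq_zero.mp h]
  rcases mul_eq_zero.mp h with h | h
  · rw [sub_eq_zero.mp h, symGauss_cubeRoot_mul]
  · rw [sub_eq_zero.mp h, symGauss_cubeRoot_mul, symGauss_cubeRoot_mul]

/-- An entire function of order `2/3`, bounded on a sector and large on the opposite one. -/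
noncomputable def gam (ζ : ℂ) : ℂ := symGauss (ζ ^ ((3 : ℕ) : ℂ)⁻¹)

theorem gam_pow_three (y : ℂ) : gam (y ^ 3) = symGauss y :=
  symGauss_eq_of_pow_three_eq (cpow_nat_inv_pow _ (by norm_num))

theorem differentiable_gam : Differentiable ℂ gam := by
  have hne : ∀ ζ₀ : ℂ, ζ₀ ≠ 0 → DifferentiableAt ℂ gam ζ₀ := by
    intro ζ₀ h0
    set c := ζ₀ ^ ((3 : ℕ) : ℂ)⁻¹ with hc
    have hc3 : c ^ 3 = ζ₀ := cpow_nat_inv_pow _ (by norm_num)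
    have heq : gam = fun ζ => symGauss (c * (ζ / ζ₀) ^ ((3 : ℕ) : ℂ)⁻¹) := by
      ext ζ
      rw [← gam_pow_three, mul_pow, hc3, cpow_nat_inv_pow _ (by norm_num), mul_div_cancel₀ _ h0]
    rw [heq]
    refine (differentiable_symGauss _).comp ζ₀ ?_
    refine DifferentiableAt.const_mul ?_ _
    refine DifferentiableAt.cpow (by fun_prop) (by fun_prop) ?_
    rw [div_self h0]
    exact one_mem_slitPlane
  have h0 : ContinuousAt gam 0 := by
    have h1 : ContinuousAt (fun ζ : ℂ => ζ ^ ((3 : ℕ) : ℂ)⁻¹) 0 := by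
      rw [ContinuousAt, zero_cpow (by norm_num), tendsto_zero_iff_norm_tendsto_zero]
      have hn : ∀ ζ : ℂ, ‖ζ ^ ((3 : ℕ) : ℂ)⁻¹‖ = ‖ζ‖ ^ ((3 : ℕ) : ℝ)⁻¹ := fun ζ =>
        norm_cpow_inv_nat ζ 3
      simp_rw [hn]
      have := (continuous_norm (E := ℂ)).tendsto 0
      simpa using this.rpow_const (p := ((3 : ℕ) : ℝ)⁻¹) (Or.inr (by positivity))
    exact (differentiable_symGauss _).continuousAt.comp h1
  rw [← differentiableOn_univ]
  rw [← differentiableOn_compl_singleton_and_continuousAt_iff (c := 0) univ_mem]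
  exact ⟨fun z hz => (hne z hz.2).differentiableWithinAt, h0⟩

theorem norm_halfGauss_le_exp_norm (y : ℂ) : ‖halfGauss y‖ ≤ 3 * Real.exp (‖y‖ ^ 2) := by
  have h1 := norm_halfGauss_le y
  have h2 : Real.exp (y ^ 2).re ≤ Real.exp (‖y‖ ^ 2) := by
    rw [Real.exp_le_exp, ← norm_pow]
    exact re_le_norm _
  have h3 : 1 ≤ Real.exp (‖y‖ ^ 2) := Real.one_le_exp (by positivity)
  linarith

theorem norm_gam_le (ζ : ℂ) : ‖gam ζ‖ ≤ 9 * Real.exp (‖ζ‖ ^ (2 / 3 : ℝ)) := by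
  set y := ζ ^ ((3 : ℕ) : ℂ)⁻¹ with hy
  have hn : ‖y‖ ^ 2 = ‖ζ‖ ^ (2 / 3 : ℝ) := by
    rw [hy, norm_cpow_inv_nat ζ 3, ← Real.rpow_natCast, ← Real.rpow_mul (norm_nonneg _)]
    norm_num
  have h1 := norm_halfGauss_le_exp_norm y
  have h2 := norm_halfGauss_le_exp_norm (cubeRoot * y)
  have h3 := norm_halfGauss_le_exp_norm (cubeRoot ^ 2 * y)
  simp only [norm_mul, norm_pow, norm_cubeRoot, one_mul, one_pow, hn] at h1 h2 h3
  calc ‖gam ζ‖ = ‖symGauss y‖ := rfl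
    _ ≤ _ := norm_add₃_le
    _ ≤ _ := by linarith

theorem re_cpow_pos {v : ℂ} {p : ℝ} (hv : 0 < v.re) (hp0 : 0 ≤ p) (hp : p ≤ 1) :
    0 < (v ^ (p : ℂ)).re := by
  have hv0 : v ≠ 0 := by rintro rfl; simp at hv
  rw [cpow_ofReal_re]
  refine mul_pos (Real.rpow_pos_of_pos (norm_pos_iff.mpr hv0) _) (Real.cos_pos_of_mem_Ioo ?_)
  have h := abs_arg_lt_pi_div_two_iff.mpr (Or.inl hv)
  rw [mem_Ioo, ← abs_lt, abs_mul, abs_of_nonneg hp0]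
  exact (mul_le_of_le_one_right (abs_nonneg _) hp).trans_lt h

theorem norm_gam_le_seven {ζ : ℂ} (h : 0 < ζ.re) (h2 : 0 ≤ (ζ ^ 2).re) : ‖gam ζ‖ ≤ 7 := by
  have h3 : √3 * √3 = 3 := Real.mul_self_sqrt (by norm_num)
  set y := ζ ^ ((3 : ℕ) : ℂ)⁻¹ with hy
  have hy3 : y ^ 3 = ζ := cpow_nat_inv_pow _ (by norm_num)
  have hyre : 0 < y.re := by
    have := re_cpow_pos (p := 1 / 3) h (by norm_num) (by norm_num)
    rw [hy]
    convert this using 3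
    push_cast; norm_num
  set a := y ^ 2 with ha
  have hare : 0 < a.re := by
    have := re_cpow_pos (p := 2 / 3) h (by norm_num) (by norm_num)
    rw [ha, hy, ← cpow_nat_mul]
    convert this using 3
    push_cast; norm_num
  have ha3 : a ^ 3 = ζ ^ 2 := by rw [ha, ← hy3]; ring
  have hare3 : (a ^ 3).re = a.re * (a.re ^ 2 - 3 * a.im ^ 2) := by
    simp [pow_succ]; ring
  have hle : 0 ≤ a.re ^ 2 - 3 * a.im ^ 2 := by
    rw [← ha3, hare3] at h2
    exact nonneg_of_mul_nonneg_right h2 hare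
  have habs : √3 * |a.im| ≤ a.re := by
    refine abs_le_of_sq_le_sq ?_ hare.le |> fun h => (le_abs_self _).trans h
    rw [mul_pow, sq_abs, pow_two (√3), h3]; linarith
  have h4 : √3 * a.im ≤ a.re :=
    (mul_le_mul_of_nonneg_left (le_abs_self _) (by positivity)).trans habs
  have h5 : √3 * (-a.im) ≤ a.re :=
    (mul_le_mul_of_nonneg_left (neg_le_abs _) (by positivity)).trans habs
  have e1 := norm_halfGauss_le_one hyre.le
  have e2 : ‖halfGauss (cubeRoot * y)‖ ≤ 3 := by
    refine norm_halfGauss_le_three ?_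
    rw [mul_pow, ← ha, cubeRoot_sq, mul_re]
    simp only; linarith
  have e3 : ‖halfGauss (cubeRoot ^ 2 * y)‖ ≤ 3 := by
    refine norm_halfGauss_le_three ?_
    have : (cubeRoot ^ 2 * y) ^ 2 = cubeRoot * a := by
      rw [ha]; linear_combination (cubeRoot * y ^ 2) * cubeRoot_pow_three
    rw [this, cubeRoot, mul_re]
    simp only; linarith
  calc ‖gam ζ‖ = ‖symGauss y‖ := rfl
    _ ≤ _ := norm_add₃_le
    _ ≤ _ := by linarith

theorem norm_gam_sub_le {x : ℂ} (h : 0 < x.re) (h2 : 0 ≤ (x ^ 2).re) :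
    ‖gam (-x ^ 3) - √Real.pi * exp (x ^ 2)‖ ≤ 7 := by
  have hg : gam (-x ^ 3) = symGauss (-x) := by
    rw [← gam_pow_three]; congr 1; ring
  have him : (x ^ 2).im = 2 * x.re * x.im := by simp [pow_two]; ring
  have h3 : 0 ≤ √3 := Real.sqrt_nonneg 3
  have e1 := norm_halfGauss_le_one h.le
  have e2 : ‖halfGauss (cubeRoot * -x)‖ ≤ 3 := by
    rcases le_total 0 x.im with hi | hi
    · refine (norm_halfGauss_le_one ?_).trans (by norm_num)
      simp only [cubeRoot, mul_re, neg_re, neg_im]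
      nlinarith [mul_nonneg h3 hi]
    · refine norm_halfGauss_le_three ?_
      have : 0 ≤ √3 * (x.re * -x.im) := mul_nonneg h3 (mul_nonneg h.le (by linarith))
      rw [mul_pow, neg_sq, cubeRoot_sq, mul_re, him]
      simp only; linarith
  have e3 : ‖halfGauss (cubeRoot ^ 2 * -x)‖ ≤ 3 := by
    rcases le_total 0 x.im with hi | hi
    · refine norm_halfGauss_le_three ?_
      have : 0 ≤ √3 * (x.re * x.im) := mul_nonneg h3 (mul_nonneg h.le hi)
      have hc : (cubeRoot ^ 2 * -x) ^ 2 = cubeRoot * x ^ 2 := by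
        linear_combination (cubeRoot * x ^ 2) * cubeRoot_pow_three
      rw [hc, cubeRoot, mul_re, him]
      simp only; linarith
    · refine (norm_halfGauss_le_one ?_).trans (by norm_num)
      simp only [cubeRoot_sq, mul_re, neg_re, neg_im]
      nlinarith [mul_nonneg h3 (neg_nonneg.mpr hi)]
  have hs : gam (-x ^ 3) - √Real.pi * exp (x ^ 2) =
      -halfGauss x + halfGauss (cubeRoot * -x) + halfGauss (cubeRoot ^ 2 * -x) := by
    rw [hg, symGauss, ← halfGauss_add_halfGauss_neg]; ring
  rw [hs]
  refine norm_add₃_le.trans ?_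
  rw [norm_neg]
  linarith

theorem exp_le_norm_gam {x : ℂ} (h : 0 < x.re) (h2 : 3 ≤ (x ^ 2).re) :
    Real.exp (x ^ 2).re ≤ ‖gam (-x ^ 3)‖ := by
  have h1 := norm_gam_sub_le h (by linarith)
  have h3 := norm_sub_norm_le (√Real.pi * exp (x ^ 2)) (√Real.pi * exp (x ^ 2) - gam (-x ^ 3))
  rw [sub_sub_cancel, norm_sub_rev _ (gam _), norm_mul, norm_exp, norm_real,
    Real.norm_of_nonneg (Real.sqrt_nonneg _)] at h3
  have h4 : (1.7 : ℝ) ≤ √Real.pi := Real.le_sqrt_of_sq_le (by linarith [Real.pi_gt_three])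
  have h5 : (16 : ℝ) ≤ Real.exp (x ^ 2).re := by
    have : (2.7 : ℝ) ^ 3 ≤ Real.exp 1 ^ 3 := by
      gcongr; linarith [Real.exp_one_gt_d9]
    rw [← Real.exp_nat_mul] at this
    have h6 : Real.exp 3 ≤ Real.exp (x ^ 2).re := Real.exp_le_exp.mpr h2
    norm_num at this
    linarith
  nlinarith [mul_le_mul_of_nonneg_right h4 (Real.exp_pos (x ^ 2).re).le]

end Gamma

section Airy

/-- Integrand of an Airy-type contour integral. -/
noncomputable def airyKernel (ζ p : ℂ) : ℂ := exp (p ^ 3 / 3 - p * ζ)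

theorem norm_airyKernel_le (ζ p : ℂ) (hp : 0 < p.re) :
    ‖airyKernel ζ p‖ ≤ Real.exp (p.re ^ 3 / 3 - p.re * ζ.re + ζ.im ^ 2 / (2 * p.re)) *
      Real.exp (-(p.re / 2) * p.im ^ 2) := by
  have h3 : (p ^ 3 / 3 - p * ζ).re =
      p.re ^ 3 / 3 - p.re * p.im ^ 2 - p.re * ζ.re + p.im * ζ.im := by
    have : (p ^ 3 / 3).re = (p ^ 3).re / 3 := by simp
    rw [sub_re, mul_re, this]
    simp [pow_succ]; ring
  rw [airyKernel, norm_exp, h3, ← Real.exp_add, Real.exp_le_exp]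
  have hsq : ζ.im ^ 2 / (2 * p.re) - p.im * ζ.im + (p.re / 2) * p.im ^ 2 =
      (ζ.im - p.re * p.im) ^ 2 / (2 * p.re) := by field_simp; ring
  have : 0 ≤ (ζ.im - p.re * p.im) ^ 2 / (2 * p.re) := by positivity
  linarith

theorem exp_neg_mul_sq_le {a : ℝ} (ha : 0 < a) (s : ℝ) :
    Real.exp (-a * s ^ 2) ≤ (1 + 1 / a) / (1 + s ^ 2) := by
  rw [neg_mul, Real.exp_neg, inv_eq_one_div, div_le_div_iff₀ (Real.exp_pos _) (by positivity)]
  have h1 := Real.add_one_le_exp (a * s ^ 2)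
  have h2 : (1 + 1 / a) * (a * s ^ 2 + 1) = a * s ^ 2 + 1 + s ^ 2 + 1 / a := by field_simp; ring
  have h3 : 0 < 1 / a := by positivity
  have h4 : 0 ≤ a * s ^ 2 := by positivity
  nlinarith [mul_le_mul_of_nonneg_left h1 (by positivity : 0 ≤ 1 + 1 / a)]

/-- An Airy-type entire function of order `2`, small on a sector. -/
noncomputable def airy (ζ : ℂ) : ℂ := ∫ s : ℝ, airyKernel ζ ((1 : ℝ) + s * I)

theorem airy_eq (ζ : ℂ) {k : ℝ} (hk : 0 < k) :
    airy ζ = ∫ s : ℝ, airyKernel ζ (k + s * I) := by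
  have key : ∀ a b : ℝ, 0 < a → a ≤ b →
      ∫ s : ℝ, airyKernel ζ (a + s * I) = ∫ s : ℝ, airyKernel ζ (b + s * I) := by
    intro a b ha hab
    refine integral_vertical_eq (K := Real.exp (b ^ 3 / 3 + b * ‖ζ‖ + ‖ζ‖ ^ 2 / (2 * a)) *
      (1 + 1 / (a / 2))) hab ?_ ?_
    · unfold airyKernel
      exact Differentiable.differentiableOn (by fun_prop)
    · intro z hz1 hz2
      have hz0 : 0 < z.re := ha.trans_le hz1
      rw [mul_div_assoc]
      refine (norm_airyKernel_le ζ z hz0).trans (mul_le_mul ?_ ?_ (Real.exp_pos _).le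
        (Real.exp_pos _).le)
      · rw [Real.exp_le_exp]
        have e1 : z.re ^ 3 ≤ b ^ 3 := by gcongr
        have e2 : z.re * -ζ.re ≤ b * ‖ζ‖ := by
          have : -ζ.re ≤ ‖ζ‖ := (neg_le_abs _).trans (abs_re_le_norm _)
          exact (mul_le_mul_of_nonneg_left this hz0.le).trans
            (mul_le_mul_of_nonneg_right hz2 (norm_nonneg _))
        have e3 : ζ.im ^ 2 / (2 * z.re) ≤ ‖ζ‖ ^ 2 / (2 * a) := by
          have : ζ.im ^ 2 ≤ ‖ζ‖ ^ 2 := by rw [← sq_abs]; gcongr; exact abs_im_le_norm _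
          gcongr
        linarith
      · refine le_trans ?_ (exp_neg_mul_sq_le (half_pos ha) z.im)
        rw [Real.exp_le_exp]
        have := mul_le_mul_of_nonneg_right hz1 (sq_nonneg z.im)
        linarith
  rcases le_total 1 k with h | h
  · exact key 1 k one_pos h
  · exact (key k 1 hk h).symm

theorem continuous_airyKernel (ζ : ℂ) (k : ℝ) :
    Continuous fun s : ℝ => airyKernel ζ (k + s * I) := by
  unfold airyKernel
  fun_prop

theorem norm_airy_le (ζ : ℂ) {k : ℝ} (hk : 0 < k) :
    ‖airy ζ‖ ≤ √(Real.pi / (k / 2)) *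
      Real.exp (k ^ 3 / 3 - k * ζ.re + ζ.im ^ 2 / (2 * k)) := by
  rw [airy_eq ζ hk, ← integral_gaussian, mul_comm, ← integral_const_mul]
  refine norm_integral_le_of_norm_le ((integrable_exp_neg_mul_sq (half_pos hk)).const_mul _)
    (Eventually.of_forall fun s => ?_)
  simpa using norm_airyKernel_le ζ (k + s * I) (by simpa using hk)

theorem differentiable_airy : Differentiable ℂ airy := by
  refine differentiable_integral_param (fun z => (continuous_airyKernel z 1).aestronglyMeasurable)
    (fun s => by unfold airyKernel; fun_prop) fun R => ?_
  refine ⟨fun s => Real.exp (1 / 3 + R + R ^ 2 / 2) * Real.exp (-(1 / 2) * s ^ 2),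
    (integrable_exp_neg_mul_sq (by norm_num)).const_mul _, fun s z hz => ?_⟩
  have h := norm_airyKernel_le z ((1 : ℝ) + s * I) (by simp)
  simp only [add_re, ofReal_re, mul_re, I_re, mul_zero, ofReal_im, I_im, mul_one, sub_self,
    add_zero, add_im, mul_im, zero_add, one_pow, one_mul] at h
  refine h.trans (mul_le_mul_of_nonneg_right ?_ (Real.exp_pos _).le)
  rw [Real.exp_le_exp]
  have e1 : -z.re ≤ R := ((neg_le_abs _).trans (abs_re_le_norm _)).trans hz
  have e2 : z.im ^ 2 ≤ R ^ 2 := by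
    rw [← sq_abs]; gcongr; exact (abs_im_le_norm _).trans hz
  linarith

theorem exists_airy_ne_zero : ∃ ζ, airy ζ ≠ 0 := by
  by_contra! h
  have hc : Continuous fun s : ℝ => airyKernel 0 ((1 : ℝ) + s * I) := continuous_airyKernel 0 1
  refine (exp_ne_zero (((1 : ℝ) + (0 : ℝ) * I : ℂ) ^ 3 / 3 - ((1 : ℝ) + (0 : ℝ) * I) * 0))
    (eq_zero_of_forall_integral_exp_eq_zero hc ?_ (fun ξ => ?_) 0)
  · refine ((integrable_exp_neg_mul_sq (b := 1 / 2) (by norm_num)).const_mul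
      (Real.exp (1 / 3))).mono' hc.aestronglyMeasurable (Eventually.of_forall fun s => ?_)
    simpa using norm_airyKernel_le 0 ((1 : ℝ) + s * I) (by simp)
  · have h1 := h (-ξ)
    rw [airy] at h1
    have h2 : ∀ s : ℝ, airyKernel (-ξ) ((1 : ℝ) + s * I) =
        exp ξ * (exp (ξ * s * I) * airyKernel 0 ((1 : ℝ) + s * I)) := by
      intro s
      simp only [airyKernel]
      rw [← exp_add, ← exp_add]
      congr 1
      push_cast
      ring
    simp_rw [h2] at h1
    rw [integral_const_mul] at h1
    exact (mul_eq_zero.mp h1).resolve_left (exp_ne_zero _)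

/-- Entire functions of order two decaying on a sector around the positive axis. -/
structure IsAiryLike (Θ : ℂ → ℂ) : Prop where
  differentiable : Differentiable ℂ Θ
  growth : ∃ K : ℝ, 0 < K ∧ ∀ ζ, ‖Θ ζ‖ ≤ K * Real.exp (‖ζ‖ ^ 2)
  decay : ∃ K : ℝ, 0 < K ∧ ∀ ζ : ℂ, 0.7 * ‖ζ‖ ≤ ζ.re →
    ‖Θ ζ‖ ≤ K * Real.exp (-(1 / 10) * √‖ζ‖ ^ 3)

theorem norm_sq_eq_re_sq_add_im_sq (ζ : ℂ) : ‖ζ‖ ^ 2 = ζ.re ^ 2 + ζ.im ^ 2 := by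
  rw [Complex.sq_norm, normSq_apply]; ring

theorem isAiryLike_airy : IsAiryLike airy := by
  have hgrowth : ∀ ζ, ‖airy ζ‖ ≤ (√(Real.pi / (1 / 2)) * Real.exp 1) * Real.exp (‖ζ‖ ^ 2) := by
    intro ζ
    refine (norm_airy_le ζ one_pos).trans ?_
    rw [mul_assoc, ← Real.exp_add]
    refine mul_le_mul_of_nonneg_left (Real.exp_le_exp.mpr ?_) (Real.sqrt_nonneg _)
    have := norm_sq_eq_re_sq_add_im_sq ζ
    nlinarith [sq_nonneg (ζ.re + 1), sq_nonneg ζ.im, sq_nonneg ζ.re]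
  refine ⟨differentiable_airy, ⟨_, by positivity, hgrowth⟩,
    ⟨√(Real.pi / (1 / 2)) * Real.exp 3, by positivity, fun ζ hζ => ?_⟩⟩
  set k := √‖ζ‖ with hk
  have hk2 : k ^ 2 = ‖ζ‖ := Real.sq_sqrt (norm_nonneg _)
  rcases le_total ‖ζ‖ 1 with h | h
  · refine (hgrowth ζ).trans ?_
    rw [mul_assoc, mul_assoc, ← Real.exp_add, ← Real.exp_add]
    refine mul_le_mul_of_nonneg_left (Real.exp_le_exp.mpr ?_) (Real.sqrt_nonneg _)
    have h1 : k ≤ 1 := Real.sqrt_le_one.mpr h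
    have h2 : k ^ 3 ≤ 1 := pow_le_one₀ (Real.sqrt_nonneg _) h1
    have h3 : ‖ζ‖ ^ 2 ≤ 1 := pow_le_one₀ (norm_nonneg _) h
    linarith
  · have hk1 : 1 ≤ k := Real.one_le_sqrt.mpr h
    have hk0 : 0 < k := by linarith
    refine (norm_airy_le ζ hk0).trans ?_
    have e1 : √(Real.pi / (k / 2)) ≤ √(Real.pi / (1 / 2)) := by
      refine Real.sqrt_le_sqrt ?_
      gcongr
    have e2 : ζ.im ^ 2 / (2 * k) ≤ 0.51 * k ^ 3 / 2 := by
      rw [div_le_iff₀ (by positivity)]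
      have h1 := norm_sq_eq_re_sq_add_im_sq ζ
      have h2 : (0.7 * ‖ζ‖) ^ 2 ≤ ζ.re ^ 2 := by gcongr
      have h3 : ‖ζ‖ ^ 2 = k ^ 4 := by rw [← hk2]; ring
      rw [mul_pow, h3] at h2
      rw [h3] at h1
      nlinarith
    have e3 : 0.7 * k ^ 3 ≤ k * ζ.re := by
      rw [← hk2] at hζ
      nlinarith [mul_le_mul_of_nonneg_left hζ hk0.le]
    have e4 : 0 < k ^ 3 := by positivity
    calc _ ≤ √(Real.pi / (1 / 2)) * Real.exp (-(1 / 10) * k ^ 3) := by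
          gcongr
          linarith
      _ ≤ _ := by
          gcongr
          have := Real.one_le_exp (x := 3) (by norm_num)
          have h5 := Real.sqrt_nonneg (Real.pi / (1 / 2))
          exact le_mul_of_one_le_right h5 this

theorem differentiable_dslope {f : ℂ → ℂ} (hf : Differentiable ℂ f) (c : ℂ) :
    Differentiable ℂ (dslope f c) := by
  rw [← differentiableOn_univ] at hf ⊢
  exact (differentiableOn_dslope univ_mem).mpr hf

theorem IsAiryLike.dslope {Θ : ℂ → ℂ} (h : IsAiryLike Θ) {ζ₀ : ℂ} (h0 : Θ ζ₀ = 0) :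
    IsAiryLike (dslope Θ ζ₀) := by
  have hd := differentiable_dslope h.differentiable ζ₀
  obtain ⟨M, hM⟩ :=
    (isCompact_closedBall ζ₀ 1).exists_bound_of_continuousOn hd.continuous.continuousOn
  have hfar : ∀ ζ, ζ ∉ Metric.closedBall ζ₀ 1 → ‖_root_.dslope Θ ζ₀ ζ‖ ≤ ‖Θ ζ‖ := by
    intro ζ hζ
    rw [Metric.mem_closedBall, dist_eq, not_le] at hζ
    have hne : ζ ≠ ζ₀ := by rintro rfl; simp at hζ; linarith
    rw [dslope_of_ne _ hne, slope_def_field, h0, sub_zero, norm_div]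
    exact div_le_self (norm_nonneg _) hζ.le
  obtain ⟨K, hK, hg⟩ := h.growth
  obtain ⟨L, hL, hdec⟩ := h.decay
  refine ⟨hd, ⟨K + |M|, by positivity, fun ζ => ?_⟩,
    ⟨L + |M| * Real.exp ((1 / 10) * √(‖ζ₀‖ + 1) ^ 3), by positivity, fun ζ hζ => ?_⟩⟩
  · by_cases hb : ζ ∈ Metric.closedBall ζ₀ 1
    · have h1 : (1 : ℝ) ≤ Real.exp (‖ζ‖ ^ 2) := Real.one_le_exp (by positivity)
      have h2 := (hM ζ hb).trans (le_abs_self M)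
      nlinarith [abs_nonneg M]
    · refine ((hfar ζ hb).trans (hg ζ)).trans ?_
      gcongr
      linarith [abs_nonneg M]
  · by_cases hb : ζ ∈ Metric.closedBall ζ₀ 1
    · have h2 := (hM ζ hb).trans (le_abs_self M)
      have h3 : ‖ζ‖ ≤ ‖ζ₀‖ + 1 := by
        rw [Metric.mem_closedBall, dist_eq] at hb
        linarith [norm_sub_norm_le ζ ζ₀]
      have h4 : 1 ≤ Real.exp ((1 / 10) * √(‖ζ₀‖ + 1) ^ 3) * Real.exp (-(1 / 10) * √‖ζ‖ ^ 3) := by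
        rw [← Real.exp_add]
        refine Real.one_le_exp ?_
        have : √‖ζ‖ ^ 3 ≤ √(‖ζ₀‖ + 1) ^ 3 := by gcongr
        linarith
      have h5 : 0 ≤ L * Real.exp (-(1 / 10) * √‖ζ‖ ^ 3) := by positivity
      rw [add_mul, mul_assoc]
      nlinarith [abs_nonneg M]
    · refine ((hfar ζ hb).trans (hdec ζ hζ)).trans ?_
      gcongr
      have : 0 ≤ |M| * Real.exp ((1 / 10) * √(‖ζ₀‖ + 1) ^ 3) := by positivity
      linarith

theorem exists_isAiryLike_ne_zero (ζ₀ : ℂ) : ∃ Θ, IsAiryLike Θ ∧ Θ ζ₀ ≠ 0 := by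
  by_contra! h
  have hiter : ∀ n : ℕ, IsAiryLike ((fun f => dslope f ζ₀)^[n] airy) := by
    intro n
    induction n with
    | zero => exact isAiryLike_airy
    | succ n ih =>
      rw [Function.iterate_succ_apply']
      exact ih.dslope (h _ ih)
  obtain ⟨p, hp⟩ : AnalyticAt ℂ airy ζ₀ := differentiable_airy.analyticAt ζ₀
  refine hp.iterate_dslope_fslope_ne_zero (fun hp0 => ?_) (h _ (hiter p.order))
  obtain ⟨z, hz⟩ := exists_airy_ne_zero
  have hev : airy =ᶠ[𝓝 ζ₀] 0 := by
    rw [hp0] at hp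
    exact hp.eventually_eq_zero
  have := AnalyticOnNhd.eq_of_eventuallyEq (f := airy) (g := 0)
    (fun z _ => differentiable_airy.analyticAt z) (fun z _ => analyticAt_const) hev
  exact hz (congrFun this z)

end Airy

section Contour

/-- The principal square root. -/
noncomputable def csqrt (v : ℂ) : ℂ := v ^ ((2 : ℕ) : ℂ)⁻¹

theorem csqrt_sq (v : ℂ) : csqrt v ^ 2 = v := cpow_nat_inv_pow _ two_ne_zero

theorem norm_csqrt (v : ℂ) : ‖csqrt v‖ = √‖v‖ := by
  rw [eq_comm, Real.sqrt_eq_iff_mul_self_eq (norm_nonneg _) (norm_nonneg _), ← pow_two, ← norm_pow,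
    csqrt_sq]

theorem csqrt_re_pos {v : ℂ} (hv : 0 < v.re) : 0 < (csqrt v).re := by
  have := re_cpow_pos (p := 1 / 2) hv (by norm_num) (by norm_num)
  rw [csqrt]
  convert this using 3
  push_cast; norm_num

theorem hasDerivAt_csqrt {v : ℂ} (hv : 0 < v.re) :
    HasDerivAt csqrt (csqrt v / (2 * v)) v := by
  have hv0 : v ≠ 0 := by rintro rfl; simp at hv
  have := (hasDerivAt_id v).cpow_const (c := ((2 : ℕ) : ℂ)⁻¹) (Or.inl hv)
  refine HasDerivAt.congr_deriv (f := csqrt) this ?_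
  simp only [id, csqrt]
  rw [cpow_sub _ _ hv0, cpow_one]
  push_cast
  field_simp

theorem csqrt_re_sq_sub (v : ℂ) : (csqrt v).re ^ 2 - (csqrt v).im ^ 2 = v.re := by
  conv_rhs => rw [← csqrt_sq v]
  simp [pow_two]

theorem csqrt_re_mul_im (v : ℂ) : 2 * (csqrt v).re * (csqrt v).im = v.im := by
  conv_rhs => rw [← csqrt_sq v]
  simp [pow_two]; ring

theorem exists_pow_mul_exp_le (C : ℝ) {c : ℝ} (hc : 0 < c) :
    ∃ K : ℝ, 0 < K ∧ ∀ t : ℝ, 0 ≤ t → t ^ 12 * Real.exp (C * t ^ 2 - c * t ^ 3) ≤ K := by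
  set M : ℝ := (|C| + 1) / c + 1 with hM
  have hM1 : 1 ≤ M := by rw [hM]; linarith [show 0 ≤ (|C| + 1) / c by positivity]
  refine ⟨(Nat.factorial 12 : ℝ) * Real.exp (|C| * M ^ 2 + M), by positivity, fun t ht => ?_⟩
  have h1 : t ^ 12 ≤ (Nat.factorial 12 : ℝ) * Real.exp t := by
    have := Real.pow_div_factorial_le_exp t ht 12
    rwa [div_le_iff₀ (by positivity), mul_comm] at this
  have h2 : t + (C * t ^ 2 - c * t ^ 3) ≤ |C| * M ^ 2 + M := by
    have h3 : C * t ^ 2 ≤ |C| * t ^ 2 := mul_le_mul_of_nonneg_right (le_abs_self C) (sq_nonneg t)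
    rcases le_total t M with h | h
    · have h4 : t ^ 2 ≤ M ^ 2 := by gcongr
      have h5 := mul_le_mul_of_nonneg_left h4 (abs_nonneg C)
      have : 0 ≤ c * t ^ 3 := by positivity
      linarith
    · have h6 : |C| + 1 ≤ c * t := by
        have : (|C| + 1) / c ≤ t := by linarith
        rwa [div_le_iff₀ hc, mul_comm] at this
      have h7 : t ≤ t ^ 2 := by nlinarith
      have h8 := mul_le_mul_of_nonneg_right h6 (sq_nonneg t)
      have : 0 ≤ |C| * M ^ 2 := by positivity
      nlinarith
  calc _ ≤ (Nat.factorial 12 : ℝ) * Real.exp t * Real.exp (C * t ^ 2 - c * t ^ 3) := by gcongr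
    _ = (Nat.factorial 12 : ℝ) * Real.exp (t + (C * t ^ 2 - c * t ^ 3)) := by
        rw [mul_assoc, ← Real.exp_add]
    _ ≤ _ := by gcongr

/-- The decaying weight on the right half-plane. -/
noncomputable def weight (v : ℂ) : ℂ := exp (-v ^ ((3 / 4 : ℝ) : ℂ))

theorem exists_exp_mul_norm_weight_le (C : ℝ) : ∃ K : ℝ, 0 < K ∧ ∀ v : ℂ, 1 ≤ v.re →
    Real.exp (C * √‖v‖) * ‖weight v‖ ≤ K / (v.re * (1 + v.im ^ 2)) := by
  have hc : 0 < Real.cos (Real.pi / 2 * (3 / 4)) :=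
    Real.cos_pos_of_mem_Ioo ⟨by linarith [Real.pi_pos], by linarith [Real.pi_pos]⟩
  obtain ⟨K, hK, hb⟩ := exists_pow_mul_exp_le C hc
  refine ⟨2 * K, by positivity, fun v hv => ?_⟩
  have hr1 : 1 ≤ ‖v‖ := hv.trans (re_le_norm v)
  have hcos : Real.cos (Real.pi / 2 * (3 / 4)) ≤ Real.cos (arg v * (3 / 4)) := by
    rw [← Real.cos_abs (arg v * (3 / 4))]
    have h := abs_arg_lt_pi_div_two_iff.mpr (Or.inl (zero_lt_one.trans_le hv))
    have h2 : |arg v * (3 / 4)| ≤ Real.pi / 2 * (3 / 4) := by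
      rw [abs_mul, abs_of_pos (show (0 : ℝ) < 3 / 4 by norm_num)]
      gcongr
    exact Real.cos_le_cos_of_nonneg_of_le_pi (abs_nonneg _) (by linarith [Real.pi_pos]) h2
  set t : ℝ := √(√‖v‖) with ht
  have ht2 : t ^ 2 = √‖v‖ := Real.sq_sqrt (Real.sqrt_nonneg _)
  have ht4 : t ^ 4 = ‖v‖ := by
    rw [show t ^ 4 = (t ^ 2) ^ 2 by ring, ht2, Real.sq_sqrt (norm_nonneg _)]
  have ht3 : ‖v‖ ^ (3 / 4 : ℝ) = t ^ 3 := by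
    have haux : ∀ u : ℝ, 0 ≤ u → (u ^ 4) ^ (3 / 4 : ℝ) = u ^ 3 := by
      intro u hu
      rw [← Real.rpow_natCast, ← Real.rpow_mul hu, ← Real.rpow_natCast]
      norm_num
    rw [← ht4, haux t (Real.sqrt_nonneg _)]
  have hw : ‖weight v‖ ≤ Real.exp (-(Real.cos (Real.pi / 2 * (3 / 4)) * t ^ 3)) := by
    rw [weight, norm_exp, Real.exp_le_exp, neg_re, cpow_ofReal_re, ht3, neg_le_neg_iff, mul_comm]
    exact mul_le_mul_of_nonneg_left hcos (by positivity)
  rw [le_div_iff₀ (by positivity)]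
  have hden : v.re * (1 + v.im ^ 2) ≤ 2 * t ^ 12 := by
    have h1 : 1 + v.im ^ 2 ≤ 2 * ‖v‖ ^ 2 := by
      have := norm_sq_eq_re_sq_add_im_sq v
      nlinarith
    calc v.re * (1 + v.im ^ 2) ≤ ‖v‖ * (2 * ‖v‖ ^ 2) := by
          gcongr
          exact re_le_norm v
      _ = 2 * t ^ 12 := by rw [← ht4]; ring
  calc _ ≤ Real.exp (C * t ^ 2) * Real.exp (-(Real.cos (Real.pi / 2 * (3 / 4)) * t ^ 3)) *
        (2 * t ^ 12) := by rw [ht2]; gcongr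
    _ = 2 * (t ^ 12 * Real.exp (C * t ^ 2 - Real.cos (Real.pi / 2 * (3 / 4)) * t ^ 3)) := by
        rw [← Real.exp_add, sub_eq_add_neg]; ring
    _ ≤ _ := by
        gcongr
        exact hb t (Real.sqrt_nonneg _)

theorem differentiableAt_weight {v : ℂ} (hv : 0 < v.re) : DifferentiableAt ℂ weight v := by
  unfold weight
  have : DifferentiableAt ℂ (fun v : ℂ => v ^ ((3 / 4 : ℝ) : ℂ)) v :=
    DifferentiableAt.cpow_const differentiableAt_fun_id (Or.inl hv)
  fun_prop

theorem continuous_weight_vertical : Continuous fun t : ℝ => weight ((1 : ℝ) + t * I) :=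
  continuous_vertical (s := {v | 0 < v.re})
    (fun v hv => (differentiableAt_weight hv).continuousAt.continuousWithinAt) (by simp)

theorem integrable_weight_vertical : Integrable fun t : ℝ => weight ((1 : ℝ) + t * I) := by
  obtain ⟨K, -, h⟩ := exists_exp_mul_norm_weight_le 0
  refine (integrable_const_div_one_add_sq K).mono' continuous_weight_vertical.aestronglyMeasurable
    (Eventually.of_forall fun t => ?_)
  simpa using h ((1 : ℝ) + t * I) (by simp)

theorem exists_integral_exp_mul_weight_ne_zero : ∃ κ : ℝ, 0 < κ ∧
    ∫ t : ℝ, exp (κ * ((1 : ℝ) + t * I)) * weight ((1 : ℝ) + t * I) ≠ 0 := by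
  by_contra! h
  have hall : ∀ κ : ℝ, ∫ t : ℝ, exp (κ * ((1 : ℝ) + t * I)) * weight ((1 : ℝ) + t * I) = 0 := by
    intro κ
    rcases lt_or_ge 0 κ with hκ | hκ
    · exact h κ hκ
    · obtain ⟨K, -, hK⟩ := exists_exp_mul_norm_weight_le 0
      refine integral_vertical_eq_zero (f := fun v => exp (κ * v) * weight v) (K := K) one_pos
        (fun v hv => ?_) fun v hv => ?_
      · have := differentiableAt_weight (zero_lt_one.trans_le hv)
        exact DifferentiableAt.differentiableWithinAt (by fun_prop)
      · refine le_trans ?_ (hK v hv)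
        rw [norm_mul, norm_exp]
        gcongr
        rw [zero_mul, re_ofReal_mul]
        exact mul_nonpos_of_nonpos_of_nonneg hκ (by linarith)
  refine exp_ne_zero _ (eq_zero_of_forall_integral_exp_eq_zero continuous_weight_vertical
    integrable_weight_vertical (fun ξ => ?_) 0)
  have h1 := hall ξ
  have h2 : ∀ t : ℝ, exp (ξ * ((1 : ℝ) + t * I)) * weight ((1 : ℝ) + t * I) =
      exp ξ * (exp (ξ * t * I) * weight ((1 : ℝ) + t * I)) := by
    intro t
    rw [← mul_assoc, ← exp_add]
    congr 2
    push_cast; ring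
  simp_rw [h2] at h1
  rw [integral_const_mul] at h1
  exact (mul_eq_zero.mp h1).resolve_left (exp_ne_zero _)

/-- The contour point `-w^{3/2}`. -/
noncomputable def ctr (w : ℂ) : ℂ := -csqrt w ^ 3

theorem ctr_sq (w : ℂ) : ctr w ^ 2 = w ^ 3 := by
  calc ctr w ^ 2 = (csqrt w ^ 2) ^ 3 := by rw [ctr]; ring
    _ = w ^ 3 := by rw [csqrt_sq]

theorem hasDerivAt_ctr {w : ℂ} (hw : 0 < w.re) : HasDerivAt ctr (-(3 / 2) * csqrt w) w := by
  have hw0 : w ≠ 0 := by rintro rfl; simp at hw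
  refine HasDerivAt.congr_deriv (f := ctr) ((hasDerivAt_csqrt hw).pow 3).neg ?_
  have := csqrt_sq w
  rw [show 3 - 1 = 2 from rfl, this]
  push_cast
  field_simp

theorem ctr_re (w : ℂ) :
    (ctr w).re = (csqrt w).re * (3 * (csqrt w).im ^ 2 - (csqrt w).re ^ 2) := by
  simp [ctr, pow_succ]; ring

theorem ctr_im (w : ℂ) :
    (ctr w).im = -((csqrt w).im * (3 * (csqrt w).re ^ 2 - (csqrt w).im ^ 2)) := by
  simp [ctr, pow_succ]; ring

theorem norm_ctr (w : ℂ) : ‖ctr w‖ = ‖csqrt w‖ ^ 3 := by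
  rw [ctr, norm_neg, norm_pow]

theorem norm_le_ctr_re {w : ℂ} (hw : 0 < w.re) (h : 200 * w.re ≤ |w.im|) :
    0.7 * ‖ctr w‖ ≤ (ctr w).re := by
  set p := (csqrt w).re with hp
  set q := (csqrt w).im with hq
  have hp0 : 0 < p := csqrt_re_pos hw
  have h1 : p ^ 2 - q ^ 2 = w.re := csqrt_re_sq_sub w
  have h2 : 2 * p * q = w.im := csqrt_re_mul_im w
  have hn : ‖csqrt w‖ ^ 2 = p ^ 2 + q ^ 2 := norm_sq_eq_re_sq_add_im_sq _
  have hre : (ctr w).re = p * (3 * q ^ 2 - p ^ 2) := ctr_re w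
  set Q := q ^ 2 with hQ
  set l := w.re with hl
  have hpQ : p ^ 2 = Q + l := by linarith
  have hQ0 : 0 ≤ Q := sq_nonneg q
  have hQl : 75 * l ≤ Q := by
    by_contra! hlt
    have h3 : (200 * l) ^ 2 ≤ w.im ^ 2 := by rw [← sq_abs w.im]; gcongr
    have h4 : w.im ^ 2 = 4 * (Q + l) * Q := by rw [← h2, ← hpQ, hQ]; ring
    have h5 : (Q + l) * Q ≤ (76 * l) * (75 * l) := by gcongr; linarith
    nlinarith
  have hpos : 0 ≤ p * (3 * Q - p ^ 2) := by
    rw [hpQ]; exact mul_nonneg hp0.le (by linarith)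
  rw [hre]
  refine le_of_sq_le_sq ?_ hpos |> fun h => h
  rw [mul_pow, norm_ctr, ← pow_mul, mul_comm 3 2, pow_mul, hn, mul_pow, hpQ]
  have : (75 * l) * Q ≤ Q * Q := by gcongr
  have h6 : 0 ≤ Q * (Q * Q - 75 * l * Q) := mul_nonneg hQ0 (by linarith)
  have h7 : 0 ≤ l * (Q * Q - 75 * l * Q) := mul_nonneg hw.le (by linarith)
  have h8 : 0 ≤ l * Q * l := by positivity
  have h9 : 0 ≤ l * l * l := by positivity
  nlinarith

/-- The integrand of the Cauchy-type integral below. -/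
noncomputable def gaussAiry (κ : ℝ) (Θ : ℂ → ℂ) (ζ : ℂ) : ℂ := exp (-κ * ζ ^ 2) * Θ ζ

theorem re_pow_three (w : ℂ) : (w ^ 3).re = w.re ^ 3 - 3 * w.re * w.im ^ 2 := by
  simp [pow_succ]; ring

theorem exists_norm_gaussAiry_ctr_le {κ : ℝ} (hκ : 0 < κ) {Θ : ℂ → ℂ} (hΘ : IsAiryLike Θ) :
    ∃ C : ℝ, 0 < C ∧ ∀ w : ℂ, 3 ≤ w.re →
      ‖gaussAiry κ Θ (ctr w)‖ ≤ Real.exp (C * w.re ^ 9 - 2 * |w.im|) := by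
  obtain ⟨K, hK, hg⟩ := hΘ.growth
  obtain ⟨L, hL, hd⟩ := hΘ.decay
  refine ⟨|Real.log K| + |Real.log L| + 201 ^ 3 + 120000 * κ + 400 + 10 ^ 8 * (3 * κ + 2) ^ 9,
    by positivity, fun w hw => ?_⟩
  set l := w.re with hl
  have hE : ‖exp (-κ * ctr w ^ 2)‖ ≤ Real.exp (3 * κ * l * w.im ^ 2) := by
    rw [norm_exp, Real.exp_le_exp, ctr_sq, ← ofReal_neg, re_ofReal_mul, re_pow_three, ← hl]
    have : 0 ≤ κ * l ^ 3 := by positivity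
    linarith
  have hl1 : 1 ≤ l := by linarith
  have hl9 : 1 ≤ l ^ 9 := one_le_pow₀ hl1
  rw [gaussAiry, norm_mul]
  have hexpK : ∀ M : ℝ, 0 < M → M ≤ Real.exp (|Real.log M| * l ^ 9) := by
    intro M hM
    conv_lhs => rw [← Real.exp_log hM]
    rw [Real.exp_le_exp]
    exact (le_abs_self _).trans (le_mul_of_one_le_right (abs_nonneg _) hl9)
  rcases le_total |w.im| (200 * l) with h | h
  · have hn : ‖ctr w‖ ^ 2 ≤ (201 * l) ^ 3 := by
      rw [← norm_pow, ctr_sq, norm_pow]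
      gcongr
      refine (norm_le_abs_re_add_abs_im w).trans ?_
      rw [abs_of_pos (show 0 < w.re by linarith)]
      linarith
    have him : w.im ^ 2 ≤ (200 * l) ^ 2 := by rw [← sq_abs]; gcongr
    calc _ ≤ Real.exp (3 * κ * l * w.im ^ 2) *
          (Real.exp (|Real.log K| * l ^ 9) * Real.exp (‖ctr w‖ ^ 2)) := by
          gcongr
          exact (hg _).trans (mul_le_mul_of_nonneg_right (hexpK K hK) (Real.exp_pos _).le)
      _ ≤ _ := by
          rw [← Real.exp_add, ← Real.exp_add, Real.exp_le_exp]
          have a1 : 3 * κ * l * w.im ^ 2 ≤ 3 * κ * l * (200 * l) ^ 2 := by gcongr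
          have a2 : l ^ 3 ≤ l ^ 9 := pow_le_pow_right₀ hl1 (by norm_num)
          have a3 : l ≤ l ^ 9 := le_self_pow₀ hl1 (by norm_num)
          have a4 : κ * l ^ 3 ≤ κ * l ^ 9 := by gcongr
          have a5 : 0 ≤ 10 ^ 8 * (3 * κ + 2) ^ 9 * l ^ 9 := by positivity
          have a6 : 0 ≤ |Real.log L| * l ^ 9 := by positivity
          nlinarith
  · set t := √(√|w.im|) with ht
    have ht2 : t ^ 2 = √|w.im| := Real.sq_sqrt (Real.sqrt_nonneg _)
    have ht4 : t ^ 4 = |w.im| := by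
      rw [show t ^ 4 = (t ^ 2) ^ 2 by ring, ht2, Real.sq_sqrt (abs_nonneg _)]
    have ht0 : 0 ≤ t := Real.sqrt_nonneg _
    have him : w.im ^ 2 = t ^ 8 := by rw [← sq_abs, ← ht4]; ring
    have ht1 : 1 ≤ t := by
      by_contra! hlt
      have : t ^ 4 ≤ 1 := pow_le_one₀ ht0 hlt.le
      linarith
    have hx : t ^ 2 ≤ ‖csqrt w‖ := by
      rw [norm_csqrt, ht2]
      exact Real.sqrt_le_sqrt (abs_im_le_norm w)
    have hc : t ^ 9 ≤ √‖ctr w‖ ^ 3 := by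
      have : t ^ 3 ≤ √‖ctr w‖ := by
        refine Real.le_sqrt_of_sq_le ?_
        rw [norm_ctr]
        calc (t ^ 3) ^ 2 = (t ^ 2) ^ 3 := by ring
          _ ≤ _ := by gcongr
      calc t ^ 9 = (t ^ 3) ^ 3 := by ring
        _ ≤ _ := by gcongr
    calc _ ≤ Real.exp (3 * κ * l * w.im ^ 2) *
          (Real.exp (|Real.log L| * l ^ 9) * Real.exp (-(1 / 10) * t ^ 9)) := by
          gcongr
          refine (hd _ (norm_le_ctr_re (by linarith) h)).trans ?_
          gcongr ?_ * Real.exp ?_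
          · exact hexpK L hL
          · linarith
      _ ≤ _ := by
          rw [← Real.exp_add, ← Real.exp_add, Real.exp_le_exp, him, ← ht4]
          set M := (3 * κ + 2) * l with hM
          have hM0 : 0 ≤ M := by positivity
          have b1 : M * t ^ 8 - (1 / 10) * t ^ 9 ≤ M * (10 * M) ^ 8 := by
            rcases le_total t (10 * M) with h5 | h5
            · have h6 : M * t ^ 8 ≤ M * (10 * M) ^ 8 := by gcongr
              have : 0 ≤ t ^ 9 := by positivity
              linarith
            · have h6 : 10 * M * t ^ 8 ≤ t * t ^ 8 := by gcongr
              have : 0 ≤ M * (10 * M) ^ 8 := by positivity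
              nlinarith
          have b2 : M * (10 * M) ^ 8 = 10 ^ 8 * (3 * κ + 2) ^ 9 * l ^ 9 := by rw [hM]; ring
          have b3 : t ^ 4 ≤ l * t ^ 8 := by
            have : t ^ 4 ≤ t ^ 8 := pow_le_pow_right₀ ht1 (by norm_num)
            exact this.trans (le_mul_of_one_le_left (by positivity) hl1)
          have b4 : M * t ^ 8 = 3 * κ * l * t ^ 8 + 2 * (l * t ^ 8) := by rw [hM]; ring
          have b5 : 0 ≤ |Real.log K| * l ^ 9 := by positivity
          have b6 : 0 ≤ κ * l ^ 9 := by positivity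
          nlinarith

theorem exists_norm_gaussAiry_ctr_mul_le {κ : ℝ} (hκ : 0 < κ) {Θ : ℂ → ℂ} (hΘ : IsAiryLike Θ) :
    ∃ C : ℝ, 0 < C ∧ ∀ w : ℂ, 3 ≤ w.re →
      ‖gaussAiry κ Θ (ctr w)‖ * ‖csqrt w‖ ≤ Real.exp (C * w.re ^ 9) / (1 + w.im ^ 2) := by
  obtain ⟨C, hC, h⟩ := exists_norm_gaussAiry_ctr_le hκ hΘ
  refine ⟨C + 2, by positivity, fun w hw => ?_⟩
  have hl1 : 1 ≤ w.re := by linarith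
  have h1 : ‖csqrt w‖ ≤ Real.exp (w.re + |w.im|) := by
    rw [norm_csqrt]
    have h2 : 1 ≤ ‖w‖ := hl1.trans (re_le_norm w)
    have h3 : √‖w‖ ≤ ‖w‖ := Real.sqrt_le_left (norm_nonneg _) |>.mpr (by nlinarith)
    have h4 := norm_le_abs_re_add_abs_im w
    rw [abs_of_pos (show 0 < w.re by linarith)] at h4
    linarith [Real.add_one_le_exp (w.re + |w.im|)]
  rw [le_div_iff₀ (by positivity)]
  have h5 : 1 + w.im ^ 2 ≤ Real.exp (w.re ^ 9 + |w.im|) := by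
    have h6 := Real.quadratic_le_exp_of_nonneg (abs_nonneg w.im)
    rw [sq_abs] at h6
    have h7 : (2 : ℝ) ≤ Real.exp (w.re ^ 9) := by
      have := Real.add_one_le_exp (w.re ^ 9)
      have : 1 ≤ w.re ^ 9 := one_le_pow₀ hl1
      linarith
    rw [Real.exp_add]
    nlinarith [abs_nonneg w.im, sq_nonneg w.im]
  calc _ ≤ Real.exp (C * w.re ^ 9 - 2 * |w.im|) * Real.exp (w.re + |w.im|) *
        Real.exp (w.re ^ 9 + |w.im|) := by
        gcongr
        exact h w hw
    _ ≤ _ := by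
        rw [← Real.exp_add, ← Real.exp_add, Real.exp_le_exp]
        have : w.re ≤ w.re ^ 9 := le_self_pow₀ hl1 (by norm_num)
        linarith

end Contour

section CauchyTransform

theorem dslope_comm (f : ℂ → ℂ) (a b : ℂ) : dslope f a b = dslope f b a := by
  rcases eq_or_ne a b with rfl | h
  · rfl
  · rw [dslope_of_ne _ h.symm, dslope_of_ne _ h, slope_comm]

theorem differentiable_gaussAiry (κ : ℝ) {Θ : ℂ → ℂ} (hΘ : IsAiryLike Θ) :
    Differentiable ℂ (gaussAiry κ Θ) := by
  have := hΘ.differentiable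
  unfold gaussAiry
  fun_prop

theorem exp_re_le_norm_gam_ctr {w : ℂ} (hw : 3 ≤ w.re) :
    Real.exp w.re ≤ ‖gam (ctr w)‖ := by
  have := exp_le_norm_gam (csqrt_re_pos (show 0 < w.re by linarith)) (by rwa [csqrt_sq])
  rwa [csqrt_sq] at this

theorem gam_ctr_ne_zero {w : ℂ} (hw : 3 ≤ w.re) : gam (ctr w) ≠ 0 :=
  norm_pos_iff.mp ((Real.exp_pos _).trans_le (exp_re_le_norm_gam_ctr hw))

theorem norm_dslope_gam_le (a z : ℂ) : ‖dslope gam a z‖ ≤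
    (9 * Real.exp 2) * Real.exp (‖z‖ ^ (2 / 3 : ℝ)) * (1 + ‖gam a‖) := by
  have hz : ∀ y, ‖y - z‖ ≤ 2 →
      ‖gam y‖ ≤ (9 * Real.exp 2) * Real.exp (‖z‖ ^ (2 / 3 : ℝ)) := by
    intro y hy
    refine (norm_gam_le y).trans ?_
    rw [mul_assoc, ← Real.exp_add]
    gcongr 9 * Real.exp ?_
    have h1 : ‖y‖ ≤ 2 + ‖z‖ := by
      have := norm_sub_norm_le y z; linarith
    calc ‖y‖ ^ (2 / 3 : ℝ) ≤ (2 + ‖z‖) ^ (2 / 3 : ℝ) := by gcongr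
      _ ≤ 2 ^ (2 / 3 : ℝ) + ‖z‖ ^ (2 / 3 : ℝ) :=
        Real.rpow_add_le_add_rpow (by norm_num) (norm_nonneg _) (by norm_num) (by norm_num)
      _ ≤ 2 ^ (1 : ℝ) + ‖z‖ ^ (2 / 3 : ℝ) := by gcongr <;> norm_num
      _ = _ := by rw [Real.rpow_one]
  set D := (9 * Real.exp 2) * Real.exp (‖z‖ ^ (2 / 3 : ℝ)) with hD
  have hD1 : 1 ≤ D := by
    have h1 : (1 : ℝ) ≤ Real.exp 2 := Real.one_le_exp (by norm_num)
    have h2 : (1 : ℝ) ≤ Real.exp (‖z‖ ^ (2 / 3 : ℝ)) := Real.one_le_exp (by positivity)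
    rw [hD]; nlinarith
  have hder : ∀ y ∈ Metric.closedBall z 1, ‖deriv gam y‖ ≤ D := by
    intro y hy
    have := norm_deriv_le_of_forall_mem_sphere_norm_le (f := gam) (c := y) (C := D)
      zero_lt_one differentiable_gam.diffContOnCl (fun x hx => hz x ?_)
    · simpa using this
    · rw [mem_closedBall_iff_norm] at hy
      rw [mem_sphere_iff_norm] at hx
      calc ‖x - z‖ = ‖(x - y) + (y - z)‖ := by congr 1; ring
        _ ≤ ‖x - y‖ + ‖y - z‖ := norm_add_le _ _
        _ ≤ 2 := by linarith
  have hle : D ≤ D * (1 + ‖gam a‖) :=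
    le_mul_of_one_le_right (by linarith) (by linarith [norm_nonneg (gam a)])
  by_cases hb : a ∈ Metric.closedBall z 1
  · refine le_trans ?_ hle
    rcases eq_or_ne z a with h | h
    · rw [← h, dslope_same]
      exact hder z (by simp)
    · rw [dslope_of_ne _ h, slope_def_field, norm_div,
        div_le_iff₀ (norm_pos_iff.mpr (sub_ne_zero.mpr h))]
      exact (convex_closedBall z 1).norm_image_sub_le_of_norm_deriv_le
        (fun x _ => differentiable_gam x) hder hb (by simp)
  · rw [mem_closedBall_iff_norm, not_le] at hb
    have hne : z ≠ a := by rintro rfl; simp at hb; linarith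
    rw [dslope_of_ne _ hne, slope_def_field, norm_div, norm_sub_rev z a]
    refine (div_le_self (norm_nonneg _) hb.le).trans ((norm_sub_le _ _).trans ?_)
    have h1 := hz z (by simp)
    have h2 : ‖gam a‖ ≤ D * ‖gam a‖ := le_mul_of_one_le_left (norm_nonneg _) hD1
    linarith

/-- Kernel whose line integrals give the coefficients of an expansion in powers of `gam`. -/
noncomputable def expansionKernel (κ : ℝ) (Θ : ℂ → ℂ) (n : ℕ) (z w : ℂ) : ℂ :=
  gaussAiry κ Θ (ctr w) * dslope gam (ctr w) z / gam (ctr w) ^ (n + 1) * (-(3 / 2) * csqrt w)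

theorem differentiableAt_expansionKernel (κ : ℝ) {Θ : ℂ → ℂ} (hΘ : IsAiryLike Θ) (n : ℕ) (z : ℂ)
    {w : ℂ} (hw : 3 ≤ w.re) : DifferentiableAt ℂ (expansionKernel κ Θ n z) w := by
  have hw0 : 0 < w.re := by linarith
  have h1 := (hasDerivAt_ctr hw0).differentiableAt
  have h2 := (hasDerivAt_csqrt hw0).differentiableAt
  have h3 : DifferentiableAt ℂ (fun w => gaussAiry κ Θ (ctr w)) w :=
    (differentiable_gaussAiry κ hΘ _).comp w h1
  have h4 : DifferentiableAt ℂ (fun w => dslope gam (ctr w) z) w := by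
    simp_rw [dslope_comm gam _ z]
    exact (differentiable_dslope differentiable_gam z _).comp w h1
  have h5 : DifferentiableAt ℂ (fun w => gam (ctr w)) w := (differentiable_gam _).comp w h1
  unfold expansionKernel
  exact ((h3.mul h4).div (h5.pow _) (pow_ne_zero _ (gam_ctr_ne_zero hw))).mul (h2.const_mul _)

theorem exists_norm_expansionKernel_le {κ : ℝ} (hκ : 0 < κ) {Θ : ℂ → ℂ} (hΘ : IsAiryLike Θ) :
    ∃ C D : ℝ, 0 < C ∧ 0 < D ∧ ∀ (n : ℕ) (z w : ℂ), 3 ≤ w.re → ‖expansionKernel κ Θ n z w‖ ≤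
      D * Real.exp (‖z‖ ^ (2 / 3 : ℝ)) * Real.exp (-(n * w.re)) * Real.exp (C * w.re ^ 9) /
        (1 + w.im ^ 2) := by
  obtain ⟨C, hC, h⟩ := exists_norm_gaussAiry_ctr_mul_le hκ hΘ
  refine ⟨C, 3 * (9 * Real.exp 2), hC, by positivity, fun n z w hw => ?_⟩
  have h1 := h w hw
  have h2 := norm_dslope_gam_le (ctr w) z
  have h3 := exp_re_le_norm_gam_ctr hw
  have h4 : 1 ≤ ‖gam (ctr w)‖ := (Real.one_le_exp (by linarith)).trans h3
  set D := (9 * Real.exp 2) * Real.exp (‖z‖ ^ (2 / 3 : ℝ)) with hD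
  set g := ‖gam (ctr w)‖ with hg
  have h5 : (1 + g) / g ^ (n + 1) ≤ 2 * Real.exp (-(n * w.re)) := by
    rw [Real.exp_neg, ← div_eq_mul_inv, Real.exp_nat_mul,
      div_le_div_iff₀ (by positivity) (by positivity)]
    have : Real.exp w.re ^ n ≤ g ^ n := by gcongr
    calc (1 + g) * Real.exp w.re ^ n ≤ (2 * g) * g ^ n := by gcongr; linarith
      _ = _ := by ring
  have h32 : ‖(-(3 / 2) : ℂ)‖ = 3 / 2 := by
    rw [norm_neg, norm_div]; simp
  rw [expansionKernel, norm_mul, norm_div, norm_mul, norm_mul, norm_pow, h32]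
  calc _ = (3 / 2) * (‖gaussAiry κ Θ (ctr w)‖ * ‖csqrt w‖) *
        (‖dslope gam (ctr w) z‖ / g ^ (n + 1)) := by ring
    _ ≤ (3 / 2) * (Real.exp (C * w.re ^ 9) / (1 + w.im ^ 2)) * (D * (1 + g) / g ^ (n + 1)) := by
        gcongr
    _ = (3 / 2) * (Real.exp (C * w.re ^ 9) / (1 + w.im ^ 2)) * (D * ((1 + g) / g ^ (n + 1))) := by
        ring
    _ ≤ (3 / 2) * (Real.exp (C * w.re ^ 9) / (1 + w.im ^ 2)) *
        (D * (2 * Real.exp (-(n * w.re)))) := by gcongr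
    _ = _ := by rw [hD]; ring

/-- Coefficient functions of the expansion of `gaussAiry` in powers of `gam`. -/
noncomputable def expansionCoeff (κ : ℝ) (Θ : ℂ → ℂ) (n : ℕ) (z : ℂ) : ℂ :=
  (2 * Real.pi : ℂ)⁻¹ * ∫ t : ℝ, expansionKernel κ Θ n z ((3 : ℝ) + t * I)

theorem continuous_expansionKernel (κ : ℝ) {Θ : ℂ → ℂ} (hΘ : IsAiryLike Θ) (n : ℕ) (z : ℂ)
    {l : ℝ} (hl : 3 ≤ l) : Continuous fun t : ℝ => expansionKernel κ Θ n z (l + t * I) :=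
  continuous_vertical (s := {v | 3 ≤ v.re})
    (fun v hv => (differentiableAt_expansionKernel κ hΘ n z hv).continuousAt.continuousWithinAt)
    (by simpa using hl)

theorem differentiable_expansionCoeff {κ : ℝ} (hκ : 0 < κ) {Θ : ℂ → ℂ} (hΘ : IsAiryLike Θ)
    (n : ℕ) : Differentiable ℂ (expansionCoeff κ Θ n) := by
  obtain ⟨C, D, hC, hD, h⟩ := exists_norm_expansionKernel_le hκ hΘ
  refine Differentiable.const_mul ?_ _
  refine differentiable_integral_param
    (fun z => (continuous_expansionKernel κ hΘ n z le_rfl).aestronglyMeasurable) (fun t => ?_)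
    fun R => ⟨fun t => D * Real.exp (|R| ^ (2 / 3 : ℝ)) * Real.exp (-(n * 3)) *
      Real.exp (C * 3 ^ 9) / (1 + t ^ 2), integrable_const_div_one_add_sq _, fun t z hz => ?_⟩
  · unfold expansionKernel
    have := differentiable_dslope differentiable_gam (ctr ((3 : ℝ) + t * I))
    exact ((this.const_mul _).div_const _).mul_const _
  · have h1 := h n z ((3 : ℝ) + t * I) (by simp)
    simp only [add_re, ofReal_re, mul_re, I_re, mul_zero, ofReal_im, I_im, mul_one, sub_self,
      add_zero, add_im, mul_im, zero_add] at h1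
    refine h1.trans ?_
    have h2 : ‖z‖ ≤ |R| := hz.trans (le_abs_self R)
    have h3 : ‖z‖ ^ (2 / 3 : ℝ) ≤ |R| ^ (2 / 3 : ℝ) :=
      Real.rpow_le_rpow (norm_nonneg z) h2 (by norm_num)
    beta_reduce
    refine div_le_div_of_nonneg_right ?_ (by positivity)
    refine mul_le_mul_of_nonneg_right ?_ (by positivity)
    refine mul_le_mul_of_nonneg_right ?_ (by positivity)
    exact mul_le_mul_of_nonneg_left (Real.exp_le_exp.mpr h3) hD.le

theorem expansionCoeff_eq {κ : ℝ} (hκ : 0 < κ) {Θ : ℂ → ℂ} (hΘ : IsAiryLike Θ)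
    (n : ℕ) (z : ℂ) {l : ℝ} (hl : 3 ≤ l) : expansionCoeff κ Θ n z =
      (2 * Real.pi : ℂ)⁻¹ * ∫ t : ℝ, expansionKernel κ Θ n z (l + t * I) := by
  obtain ⟨C, D, hC, hD, h⟩ := exists_norm_expansionKernel_le hκ hΘ
  rw [expansionCoeff]
  congr 1
  refine integral_vertical_eq (K := D * Real.exp (‖z‖ ^ (2 / 3 : ℝ)) * 1 * Real.exp (C * l ^ 9))
    hl (fun w hw => ?_) fun w hw1 hw2 => ?_
  · exact (differentiableAt_expansionKernel κ hΘ n z hw.1).differentiableWithinAt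
  · refine (h n z w hw1).trans ?_
    have h0 : 0 ≤ w.re := by linarith
    gcongr
    rw [Real.exp_le_one_iff]
    have : 0 ≤ (n : ℝ) * w.re := by positivity
    linarith

/-- A sequence of entire functions with factorial decay and growth of order `2/3`. -/
structure IsFactorialDecay (ψ : ℕ → ℂ → ℂ) : Prop where
  differentiable : ∀ n, Differentiable ℂ (ψ n)
  bound : ∃ K A : ℝ, 0 < K ∧ 0 < A ∧ ∀ n z, ‖ψ n z‖ ≤
    K * A ^ n / (n.factorial : ℝ) ^ (3 / 2 : ℝ) * Real.exp (‖z‖ ^ (2 / 3 : ℝ))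

theorem isFactorialDecay_expansionCoeff {κ : ℝ} (hκ : 0 < κ) {Θ : ℂ → ℂ} (hΘ : IsAiryLike Θ) :
    IsFactorialDecay (expansionCoeff κ Θ) := by
  obtain ⟨C, D, hC, hD, h⟩ := exists_norm_expansionKernel_le hκ hΘ
  set J : ℝ := ∫ t : ℝ, 1 / (1 + t ^ 2) with hJ
  have hJ0 : 0 ≤ J := integral_nonneg fun t => by positivity
  set A := Real.exp (C * 17 ^ 9) with hA
  have hpi : ‖(2 * Real.pi : ℂ)⁻¹‖ ≤ 1 := by
    rw [norm_inv]
    refine inv_le_one_of_one_le₀ ?_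
    simp only [norm_mul, norm_ofNat, norm_real, Real.norm_of_nonneg Real.pi_pos.le]
    linarith [Real.pi_gt_three]
  refine ⟨fun n => differentiable_expansionCoeff hκ hΘ n,
    ⟨D * A * J + 1, A, by positivity, by positivity, fun n z => ?_⟩⟩
  set N : ℝ := n + 1 with hN
  have hN1 : 1 ≤ N := by simp [hN]
  have hN0 : 0 < N := by linarith
  have hlog : 0 ≤ Real.log N := Real.log_nonneg hN1
  set l : ℝ := 3 / 2 * Real.log N + 3 with hl
  have hl3 : 3 ≤ l := by linarith
  have hl9 : l ^ 9 ≤ 17 ^ 9 * N := by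
    have h1 : Real.log N ≤ N ^ (1 / 9 : ℝ) / (1 / 9 : ℝ) :=
      Real.log_le_rpow_div hN0.le (by norm_num)
    have h2 : 1 ≤ N ^ (1 / 9 : ℝ) := Real.one_le_rpow hN1 (by norm_num)
    have h3 : l ≤ 17 * N ^ (1 / 9 : ℝ) := by linarith
    calc l ^ 9 ≤ (17 * N ^ (1 / 9 : ℝ)) ^ 9 := by gcongr
      _ = 17 ^ 9 * N := by
        rw [mul_pow, ← Real.rpow_natCast (N ^ (1 / 9 : ℝ)), ← Real.rpow_mul hN0.le]
        norm_num
  have hfac : Real.exp (-(n * l)) ≤ 1 / (n.factorial : ℝ) ^ (3 / 2 : ℝ) := by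
    rw [Real.exp_neg, ← one_div]
    refine one_div_le_one_div_of_le (by positivity) ?_
    have h1 : (n.factorial : ℝ) ≤ N ^ n := by
      have : (n.factorial : ℝ) ≤ (n : ℝ) ^ n := by exact_mod_cast Nat.factorial_le_pow n
      refine this.trans ?_
      gcongr
      linarith
    calc (n.factorial : ℝ) ^ (3 / 2 : ℝ) ≤ (N ^ n) ^ (3 / 2 : ℝ) := by gcongr
      _ = Real.exp (n * (3 / 2 * Real.log N)) := by
        rw [← Real.rpow_natCast, ← Real.rpow_mul hN0.le, Real.rpow_def_of_pos hN0]
        congr 1; ring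
      _ ≤ _ := by gcongr; linarith
  have hgrow : Real.exp (C * l ^ 9) ≤ A * A ^ n := by
    rw [← pow_succ', hA, ← Real.exp_nat_mul, Real.exp_le_exp]
    push_cast
    have := mul_le_mul_of_nonneg_left hl9 hC.le
    linarith
  rw [expansionCoeff_eq hκ hΘ n z hl3, norm_mul]
  have hint : ‖∫ t : ℝ, expansionKernel κ Θ n z (l + t * I)‖ ≤
      D * Real.exp (‖z‖ ^ (2 / 3 : ℝ)) * Real.exp (-(n * l)) * Real.exp (C * l ^ 9) * J := by
    rw [hJ, ← integral_const_mul]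
    refine norm_integral_le_of_norm_le ((integrable_const_div_one_add_sq 1).const_mul _)
      (Eventually.of_forall fun t => ?_)
    have h1 := h n z (l + t * I) (by simpa using hl3)
    simp only [add_re, ofReal_re, mul_re, I_re, mul_zero, ofReal_im, I_im, mul_one, sub_self,
      add_zero, add_im, mul_im, zero_add] at h1
    rwa [mul_one_div]
  calc _ ≤ 1 * (D * Real.exp (‖z‖ ^ (2 / 3 : ℝ)) * Real.exp (-(n * l)) *
        Real.exp (C * l ^ 9) * J) := mul_le_mul hpi hint (norm_nonneg _) zero_le_one
    _ ≤ 1 * (D * Real.exp (‖z‖ ^ (2 / 3 : ℝ)) * (1 / (n.factorial : ℝ) ^ (3 / 2 : ℝ)) *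
        (A * A ^ n) * J) := by gcongr
    _ = (D * A * J) * A ^ n / (n.factorial : ℝ) ^ (3 / 2 : ℝ) * Real.exp (‖z‖ ^ (2 / 3 : ℝ)) := by
        ring
    _ ≤ _ := by gcongr; linarith

end CauchyTransform

section CauchyFormula

theorem csqrt_conj {v : ℂ} (hv : 0 < v.re) :
    csqrt (starRingEnd ℂ v) = starRingEnd ℂ (csqrt v) := by
  have h1 : csqrt (starRingEnd ℂ v) ^ 2 = (starRingEnd ℂ (csqrt v)) ^ 2 := by
    rw [csqrt_sq, ← map_pow, csqrt_sq]
  rcases sq_eq_sq_iff_eq_or_eq_neg.mp h1 with h | h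
  · exact h
  · have h2 : 0 < (csqrt (starRingEnd ℂ v)).re := csqrt_re_pos (by simpa using hv)
    have h3 := csqrt_re_pos hv
    rw [h] at h2
    simp at h2
    linarith

theorem ctr_conj {w : ℂ} (hw : 0 < w.re) : ctr (starRingEnd ℂ w) = starRingEnd ℂ (ctr w) := by
  simp [ctr, csqrt_conj hw]

theorem norm_residue_sub_le {E Q : ℂ → ℂ} {z X Y M : ℝ} (hQ : ∀ ξ, HasDerivAt Q (dslope E z ξ) ξ)
    (hX : z < X) (hY : 0 < Y) (hM : ∀ s : ℝ, |s| ≤ Y → ‖E (X + s * I) / (X + s * I - z)‖ ≤ M) :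
    ‖Q (X - Y * I) - Q (X + Y * I) + E z * (log (z - (X - Y * I)) - log (z - (X + Y * I)))
      - 2 * Real.pi * I * E z‖ ≤ M * (2 * Y) := by
  have hne : ∀ s : ℝ, (X + s * I - z : ℂ) ∈ slitPlane := fun s => by
    rw [mem_slitPlane_iff]; left; simpa using hX
  have hderiv : ∀ s : ℝ, HasDerivAt
      (fun s : ℝ => Q (X + s * I) + E z * log (X + s * I - z))
      (E (X + s * I) / (X + s * I - z) * I) s := by
    intro s
    have h1 : HasDerivAt (fun s : ℝ => (X + s * I : ℂ)) I s := by
      simpa using (((hasDerivAt_id s).ofReal_comp).mul_const I).const_add (X : ℂ)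
    have h2 := (hQ (X + s * I)).comp s h1
    have h3 : HasDerivAt (fun s : ℝ => log (X + s * I - z : ℂ)) (I / (X + s * I - z)) s :=
      (h1.sub_const (z : ℂ)).clog_real (hne s)
    refine HasDerivAt.congr_deriv (f := fun s : ℝ => Q (X + s * I) + E z * log (X + s * I - z))
      (h2.add (h3.const_mul (E z))) ?_
    have h4 := slitPlane_ne_zero (hne s)
    rw [dslope_of_ne _ (sub_ne_zero.mp h4), slope_def_field]
    field_simp
    ring
  have hmain := (convex_Icc (-Y) Y).norm_image_sub_le_of_norm_hasDerivWithin_le (C := M)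
    (fun s _ => (hderiv s).hasDerivWithinAt)
    (fun s hs => by simpa using hM s (abs_le.mpr hs)) (x := Y) (y := -Y)
    (by constructor <;> linarith) (by constructor <;> linarith)
  have hY' : ‖-Y - Y‖ = 2 * Y := by
    rw [Real.norm_eq_abs, abs_of_neg (by linarith)]; ring
  rw [hY'] at hmain
  refine le_trans (le_of_eq ?_) hmain
  have ha : log (z - (X - Y * I) : ℂ) = log (X - Y * I - z) + Real.pi * I := by
    have h0 : (X - Y * I - z : ℂ).im < 0 := by simpa using hY
    have : (z - (X - Y * I) : ℂ) = -(X - Y * I - z) := by ring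
    rw [this, log, log, norm_neg, arg_neg_eq_arg_add_pi_of_im_neg h0]
    push_cast; ring
  have hb : log (z - (X + Y * I) : ℂ) = log (X + Y * I - z) - Real.pi * I := by
    have h0 : 0 < (X + Y * I - z : ℂ).im := by simpa using hY
    have : (z - (X + Y * I) : ℂ) = -(X + Y * I - z) := by ring
    rw [this, log, log, norm_neg, arg_neg_eq_arg_sub_pi_of_im_pos h0]
    push_cast; ring
  rw [ha, hb]
  congr 1
  push_cast
  have e : (X + -(Y : ℂ) * I) = X - Y * I := by ring
  rw [e]
  ring

theorem sub_ctr_mem_slitPlane {w : ℂ} (hw : 0 < w.re) {z : ℝ} (hz : 0 < z) :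
    (z - ctr w : ℂ) ∈ slitPlane := by
  have hp := csqrt_re_pos hw
  have h1 := csqrt_re_sq_sub w
  rw [mem_slitPlane_iff]
  by_cases hq : (csqrt w).im = 0
  · left
    rw [sub_re, ofReal_re, ctr_re, hq]
    have : 0 < (csqrt w).re ^ 3 := by positivity
    nlinarith
  · right
    rw [sub_im, ofReal_im, ctr_im]
    have : 3 * (csqrt w).re ^ 2 - (csqrt w).im ^ 2 ≠ 0 := by nlinarith
    simpa using ⟨hq, this⟩

theorem two_le_norm_gam_ratio {w : ℂ} (hw : 3 ≤ w.re) {y : ℂ} (hy : ‖y‖ ≤ 7) :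
    ‖gam (ctr w)‖ ≤ 2 * ‖gam (ctr w) - y‖ ∧ ‖y / gam (ctr w)‖ ≤ 1 / 2 := by
  have h1 := exp_re_le_norm_gam_ctr hw
  have h2 : (14 : ℝ) ≤ Real.exp w.re := by
    have : (14 : ℝ) ≤ Real.exp 1 ^ 3 := by
      have := Real.exp_one_gt_d9
      calc (14 : ℝ) ≤ 2.7182818283 ^ 3 := by norm_num
        _ ≤ _ := by gcongr
    rw [← Real.exp_nat_mul] at this
    refine this.trans (Real.exp_le_exp.mpr ?_)
    push_cast; linarith
  have h3 := norm_sub_norm_le (gam (ctr w)) y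
  refine ⟨by linarith, ?_⟩
  rw [norm_div, div_le_iff₀ (by linarith)]
  linarith

theorem gaussAiry_div_eq (κ : ℝ) (Θ : ℂ → ℂ) {w z : ℂ} (hw : 3 ≤ w.re) (hz : ‖gam z‖ ≤ 7) :
    gaussAiry κ Θ (ctr w) / (ctr w - z) * (-(3 / 2) * csqrt w) =
      expansionKernel κ Θ 0 z w * (gam (ctr w) / (gam (ctr w) - gam z)) := by
  have h1 := (two_le_norm_gam_ratio hw hz).1
  have h2 := gam_ctr_ne_zero hw
  have h3 : gam (ctr w) - gam z ≠ 0 := by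
    intro h
    rw [h] at h1
    have := norm_pos_iff.mpr h2
    simp at h1
    exact h2 h1
  have h4 : ctr w - z ≠ 0 := by
    intro h
    rw [sub_eq_zero.mp h] at h3
    simp at h3
  have h5 : z - ctr w ≠ 0 := by rw [← neg_sub]; exact neg_ne_zero.mpr h4
  rw [expansionKernel, dslope_of_ne _ (sub_ne_zero.mp h5), slope_def_field]
  have h6 : (gam z - gam (ctr w)) / (z - ctr w) = (gam (ctr w) - gam z) / (ctr w - z) := by
    rw [← neg_sub, ← neg_sub (ctr w), neg_div_neg_eq]
  rw [h6, zero_add, pow_one]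
  field_simp

theorem continuous_ctr_vertical {l : ℝ} (hl : 0 < l) : Continuous fun t : ℝ => ctr (l + t * I) :=
  continuous_vertical (s := {v | 0 < v.re})
    (fun _ hv => (hasDerivAt_ctr hv).continuousAt.continuousWithinAt) (by simpa using hl)

theorem norm_expansionKernel_mul_le {κ : ℝ} (hκ : 0 < κ) {Θ : ℂ → ℂ} (hΘ : IsAiryLike Θ) (z : ℂ) :
    ∃ M : ℝ, 0 < M ∧ ∀ (n : ℕ) (t : ℝ), ‖expansionKernel κ Θ n z ((3 : ℝ) + t * I)‖ ≤
      M * Real.exp (-3) ^ n / (1 + t ^ 2) := by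
  obtain ⟨C, D, hC, hD, h⟩ := exists_norm_expansionKernel_le hκ hΘ
  refine ⟨D * Real.exp (‖z‖ ^ (2 / 3 : ℝ)) * Real.exp (C * 3 ^ 9), by positivity, fun n t => ?_⟩
  have h1 := h n z ((3 : ℝ) + t * I) (by simp)
  simp only [add_re, ofReal_re, mul_re, I_re, mul_zero, ofReal_im, I_im, mul_one, sub_self,
    add_zero, add_im, mul_im, zero_add] at h1
  refine h1.trans (le_of_eq ?_)
  rw [← Real.exp_nat_mul, show (n : ℝ) * -3 = -(n * 3) by ring]
  ring

theorem integrable_expansionKernel {κ : ℝ} (hκ : 0 < κ) {Θ : ℂ → ℂ} (hΘ : IsAiryLike Θ) (n : ℕ)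
    (z : ℂ) : Integrable fun t : ℝ => expansionKernel κ Θ n z ((3 : ℝ) + t * I) := by
  obtain ⟨M, hM, h⟩ := norm_expansionKernel_mul_le hκ hΘ z
  exact (integrable_const_div_one_add_sq _).mono'
    (continuous_expansionKernel κ hΘ n z le_rfl).aestronglyMeasurable
    (Eventually.of_forall (h n))

/-- Integrand of the Cauchy formula for `gaussAiry` along the contour `ctr`. -/
noncomputable def cauchyIntegrand (κ : ℝ) (Θ : ℂ → ℂ) (z : ℂ) (t : ℝ) : ℂ :=
  gaussAiry κ Θ (ctr ((3 : ℝ) + t * I)) / (ctr ((3 : ℝ) + t * I) - z) *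
    (-(3 / 2) * csqrt ((3 : ℝ) + t * I))

theorem continuous_cauchyIntegrand (κ : ℝ) {Θ : ℂ → ℂ} (hΘ : IsAiryLike Θ) {z : ℝ} (hz : 0 < z) :
    Continuous (cauchyIntegrand κ Θ z) := by
  have h1 := continuous_ctr_vertical (show (0 : ℝ) < 3 by norm_num)
  have h2 : Continuous fun t : ℝ => csqrt ((3 : ℝ) + t * I) :=
    continuous_vertical (s := {v | 0 < v.re})
      (fun _ hv => (hasDerivAt_csqrt hv).continuousAt.continuousWithinAt) (by simp)
  refine Continuous.mul (((differentiable_gaussAiry κ hΘ).continuous.comp h1).div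
    (h1.sub continuous_const) fun t => ?_) (continuous_const.mul h2)
  have := slitPlane_ne_zero (sub_ctr_mem_slitPlane (w := (3 : ℝ) + t * I) (by simp) hz)
  rw [← neg_sub]
  exact neg_ne_zero.mpr this

theorem norm_gam_ofReal_le {z : ℝ} (hz : 0 < z) : ‖gam z‖ ≤ 7 :=
  norm_gam_le_seven (by simpa using hz) (by rw [← ofReal_pow, ofReal_re]; positivity)

theorem integrable_cauchyIntegrand {κ : ℝ} (hκ : 0 < κ) {Θ : ℂ → ℂ} (hΘ : IsAiryLike Θ) {z : ℝ}
    (hz : 0 < z) : Integrable (cauchyIntegrand κ Θ z) := by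
  refine ((integrable_expansionKernel hκ hΘ 0 z).norm.mul_const 2).mono'
    (continuous_cauchyIntegrand κ hΘ hz).aestronglyMeasurable (Eventually.of_forall fun t => ?_)
  have hw : 3 ≤ (((3 : ℝ) : ℂ) + t * I).re := by simp
  rw [cauchyIntegrand, gaussAiry_div_eq κ Θ hw (norm_gam_ofReal_le hz), norm_mul, norm_div]
  refine mul_le_mul_of_nonneg_left ?_ (norm_nonneg _)
  exact div_le_of_le_mul₀ (norm_nonneg _) (by norm_num)
    (two_le_norm_gam_ratio hw (norm_gam_ofReal_le hz)).1

theorem norm_integral_cauchyIntegrand_sub_le (κ : ℝ) {Θ : ℂ → ℂ} (hΘ : IsAiryLike Θ) {z T M : ℝ}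
    (hz : 0 < z) (hT : 0 < T) (hX : z < (ctr ((3 : ℝ) + T * I)).re)
    (hM : ∀ s : ℝ, |s| ≤ |(ctr ((3 : ℝ) + T * I)).im| →
      ‖gaussAiry κ Θ ((ctr ((3 : ℝ) + T * I)).re + s * I) /
        ((ctr ((3 : ℝ) + T * I)).re + s * I - z)‖ ≤ M) :
    ‖(∫ t in (-T)..T, cauchyIntegrand κ Θ z t * I) - 2 * Real.pi * I * gaussAiry κ Θ z‖ ≤
      M * (2 * |(ctr ((3 : ℝ) + T * I)).im|) := by
  set E := gaussAiry κ Θ with hE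
  obtain ⟨Q, hQ⟩ := (differentiable_dslope (differentiable_gaussAiry κ hΘ) (z : ℂ)).isExactOn_univ
  replace hQ := fun ξ => hQ ξ (mem_univ ξ)
  have hpos : ∀ t : ℝ, 0 < (((3 : ℝ) : ℂ) + t * I).re := by simp
  have hderiv : ∀ t : ℝ, HasDerivAt (fun t : ℝ => Q (ctr ((3 : ℝ) + t * I)) +
      E z * log (z - ctr ((3 : ℝ) + t * I))) (cauchyIntegrand κ Θ z t * I) t := by
    intro t
    have h1 : HasDerivAt (fun s : ℝ => ((3 : ℝ) + s * I : ℂ)) I t := by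
      simpa using (((hasDerivAt_id t).ofReal_comp).mul_const I).const_add ((3 : ℝ) : ℂ)
    have h2 := (hasDerivAt_ctr (hpos t)).comp t h1
    have h3 := (hQ (ctr ((3 : ℝ) + t * I))).comp t h2
    have hs := sub_ctr_mem_slitPlane (hpos t) hz
    have h4 : HasDerivAt (fun t : ℝ => log (z - ctr ((3 : ℝ) + t * I) : ℂ)) _ t :=
      (h2.const_sub (z : ℂ)).clog_real hs
    refine HasDerivAt.congr_deriv (f := fun t : ℝ => Q (ctr ((3 : ℝ) + t * I)) +
      E z * log (z - ctr ((3 : ℝ) + t * I))) (h3.add (h4.const_mul (E z))) ?_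
    have h5 := slitPlane_ne_zero hs
    have h6 : ctr ((3 : ℝ) + t * I) - z ≠ 0 := by rw [← neg_sub]; exact neg_ne_zero.mpr h5
    rw [dslope_of_ne _ (sub_ne_zero.mp h6), slope_def_field, cauchyIntegrand, Function.comp_apply,
      ← neg_sub (ctr ((3 : ℝ) + t * I)) (z : ℂ)]
    field_simp
    ring
  have hcont : Continuous fun t => cauchyIntegrand κ Θ z t * I :=
    (continuous_cauchyIntegrand κ hΘ hz).mul continuous_const
  rw [intervalIntegral.integral_eq_sub_of_hasDerivAt (fun t _ => hderiv t)
    (hcont.intervalIntegrable _ _)]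
  set a := ctr ((3 : ℝ) + T * I) with ha
  have hconj : ctr ((3 : ℝ) + (-T : ℝ) * I) = starRingEnd ℂ a := by
    rw [ha, ← ctr_conj (hpos T), map_add, map_mul, conj_ofReal, conj_ofReal, conj_I, ofReal_neg,
      neg_mul, mul_neg]
  have him : a.im < 0 := by
    have hp := csqrt_re_pos (hpos T)
    have h1 := csqrt_re_sq_sub ((3 : ℝ) + T * I)
    have h2 := csqrt_re_mul_im ((3 : ℝ) + T * I)
    simp only [add_re, ofReal_re, mul_re, I_re, mul_zero, ofReal_im, I_im, mul_one, sub_self,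
      add_zero, add_im, mul_im, zero_add] at h1 h2
    have h3 : 0 < (csqrt ((3 : ℝ) + T * I)).im := by
      by_contra hcon
      push Not at hcon
      nlinarith
    rw [ha, ctr_im, neg_lt_zero]
    refine mul_pos h3 ?_
    nlinarith
  have hY : |a.im| = -a.im := abs_of_neg him
  have hmain := norm_residue_sub_le (E := E) (Y := |a.im|) hQ hX (abs_pos.mpr him.ne) hM
  refine le_trans (le_of_eq ?_) hmain
  have e1 : (a.re - (|a.im| : ℝ) * I : ℂ) = a := by
    rw [hY]; push_cast; rw [neg_mul, sub_neg_eq_add, re_add_im]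
  have e2 : (a.re + (|a.im| : ℝ) * I : ℂ) = starRingEnd ℂ a := by
    rw [hY]; apply Complex.ext <;> simp
  rw [e1, e2, hconj]
  congr 1
  ring

theorem eventually_norm_integral_cauchyIntegrand_le {κ : ℝ} (hκ : 0 < κ) {Θ : ℂ → ℂ}
    (hΘ : IsAiryLike Θ) {z : ℝ} (hz : 0 < z) : ∃ K : ℝ, ∀ᶠ S : ℝ in atTop,
      ‖(∫ t in (-S ^ 4)..(S ^ 4), cauchyIntegrand κ Θ z t * I) -
        2 * Real.pi * I * gaussAiry κ Θ z‖ ≤ K / S := by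
  obtain ⟨K, hK, hd⟩ := hΘ.decay
  refine ⟨16 * K, ?_⟩
  filter_upwards [eventually_ge_atTop (2 * (z + 1)), eventually_ge_atTop (20 * (9 * κ + 2)),
    eventually_ge_atTop 10] with S h1 h2 h3
  set T := S ^ 4 with hT
  have hT600 : 600 ≤ T := by
    calc (600 : ℝ) ≤ 10 ^ 4 := by norm_num
      _ ≤ S ^ 4 := by gcongr
  set w : ℂ := (3 : ℝ) + T * I with hw
  have hwre : w.re = 3 := by simp [hw]
  have hwim : w.im = T := by simp [hw]
  have hwn1 : T ≤ ‖w‖ := by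
    have := abs_im_le_norm w; rw [hwim, abs_of_pos (by linarith)] at this; exact this
  have hwn2 : ‖w‖ ≤ 4 * T := by
    have := norm_le_abs_re_add_abs_im w
    rw [hwre, hwim, abs_of_pos (by linarith), abs_of_pos (by linarith)] at this
    linarith
  have hs1 : S ^ 2 ≤ √‖w‖ := Real.le_sqrt_of_sq_le (by rw [← pow_mul]; exact hwn1)
  have hs2 : √‖w‖ ≤ 2 * S ^ 2 := by
    rw [Real.sqrt_le_left (by positivity)]
    calc ‖w‖ ≤ 4 * T := hwn2
      _ = _ := by rw [hT]; ring
  have ha1 : S ^ 6 ≤ ‖ctr w‖ := by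
    rw [norm_ctr, norm_csqrt]
    calc S ^ 6 = (S ^ 2) ^ 3 := by ring
      _ ≤ _ := by gcongr
  have ha2 : ‖ctr w‖ ≤ 8 * S ^ 6 := by
    rw [norm_ctr, norm_csqrt]
    calc _ ≤ (2 * S ^ 2) ^ 3 := by gcongr
      _ = _ := by ring
  have hre : 0.7 * ‖ctr w‖ ≤ (ctr w).re := norm_le_ctr_re (by rw [hwre]; norm_num) (by
    rw [hwre, hwim, abs_of_pos (by linarith)]; linarith)
  have hS6 : S ≤ S ^ 6 := le_self_pow₀ (by linarith) (by norm_num)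
  have hX : z + 1 ≤ (ctr w).re := by norm_num at hre; linarith
  have hpos : 0 < (ctr w).re := by linarith
  have him : |(ctr w).im| ≤ 8 * S ^ 6 := (abs_im_le_norm _).trans ha2
  have hsq : -(9 * S ^ 8) ≤ (ctr w).re ^ 2 - (ctr w).im ^ 2 := by
    have e1 : (ctr w ^ 2).re = (ctr w).re ^ 2 - (ctr w).im ^ 2 := by simp [pow_two]
    rw [← e1, ctr_sq, re_pow_three, hwre, hwim, hT]
    have : (S ^ 4) ^ 2 = S ^ 8 := by ring
    rw [this]; linarith
  refine (norm_integral_cauchyIntegrand_sub_le κ hΘ (M := K * Real.exp (-2 * S ^ 8)) hz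
    (by linarith) (by linarith) fun s hs => ?_).trans ?_
  · set ξ : ℂ := (ctr w).re + s * I with hξ
    have hξre : ξ.re = (ctr w).re := by simp [hξ]
    have hξim : ξ.im = s := by simp [hξ]
    have hξn : ‖ξ‖ ≤ ‖ctr w‖ := by
      rw [← abs_of_nonneg (norm_nonneg ξ), ← abs_of_nonneg (norm_nonneg (ctr w)), ← sq_le_sq,
        norm_sq_eq_re_sq_add_im_sq, norm_sq_eq_re_sq_add_im_sq, hξre, hξim]
      have := sq_le_sq.mpr hs
      linarith
    have hdec := hd ξ (by rw [hξre]; norm_num at hre ⊢; linarith)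
    have hlow : 0.5 * S ^ 9 ≤ √‖ξ‖ ^ 3 := by
      have e1 : (ctr w).re ≤ ‖ξ‖ := by rw [← hξre]; exact re_le_norm ξ
      have e2 : 0.8 * S ^ 3 ≤ √‖ξ‖ := by
        refine Real.le_sqrt_of_sq_le ?_
        have : (0.8 * S ^ 3) ^ 2 = 0.64 * S ^ 6 := by ring
        rw [this]
        norm_num at hre ⊢
        linarith
      calc 0.5 * S ^ 9 ≤ (0.8 * S ^ 3) ^ 3 := by
            have : (0.8 * S ^ 3) ^ 3 = 0.512 * S ^ 9 := by ring
            rw [this]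
            gcongr
            norm_num
        _ ≤ _ := by gcongr
    have hden : 1 ≤ ‖ξ - z‖ := by
      have := re_le_norm (ξ - z)
      rw [sub_re, ofReal_re, hξre] at this
      linarith
    have hgauss : ‖exp (-κ * ξ ^ 2)‖ ≤ Real.exp (9 * κ * S ^ 8) := by
      rw [norm_exp, Real.exp_le_exp]
      have e1 : (-(κ : ℂ) * ξ ^ 2).re = -κ * (ξ.re ^ 2 - ξ.im ^ 2) := by
        simp [pow_two]
      rw [e1, hξre, hξim]
      have := sq_le_sq.mpr hs
      have := mul_le_mul_of_nonneg_left (show -(9 * S ^ 8) ≤ (ctr w).re ^ 2 - s ^ 2 by linarith)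
        hκ.le
      linarith
    rw [norm_div]
    refine (div_le_self (norm_nonneg _) hden).trans ?_
    rw [gaussAiry, norm_mul]
    calc _ ≤ Real.exp (9 * κ * S ^ 8) * (K * Real.exp (-(1 / 10) * √‖ξ‖ ^ 3)) := by gcongr
      _ = K * Real.exp (9 * κ * S ^ 8 + -(1 / 10) * √‖ξ‖ ^ 3) := by rw [Real.exp_add]; ring
      _ ≤ _ := by
        refine mul_le_mul_of_nonneg_left (Real.exp_le_exp.mpr ?_) hK.le
        have : 20 * (9 * κ + 2) * S ^ 8 ≤ S * S ^ 8 := by gcongr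
        have e9 : S * S ^ 8 = S ^ 9 := by ring
        rw [e9] at this
        norm_num at hlow ⊢
        linarith
  · have e1 : S ^ 8 ≤ Real.exp (S ^ 8) := by linarith [Real.add_one_le_exp (S ^ 8)]
    have e2 : S ^ 6 ≤ S ^ 8 := pow_le_pow_right₀ (by linarith) (by norm_num)
    have e3 : S ≤ S ^ 8 := le_self_pow₀ (by linarith) (by norm_num)
    have e4 : Real.exp (-2 * S ^ 8) = 1 / (Real.exp (S ^ 8) * Real.exp (S ^ 8)) := by
      rw [← Real.exp_add, one_div, ← Real.exp_neg]; congr 1; ring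
    have hS0 : 0 < S := by linarith
    calc _ ≤ K * Real.exp (-2 * S ^ 8) * (2 * (8 * S ^ 6)) := by gcongr
      _ = 16 * K * (S ^ 6 / (Real.exp (S ^ 8) * Real.exp (S ^ 8))) := by rw [e4]; ring
      _ ≤ 16 * K * (1 / S) := by
        refine mul_le_mul_of_nonneg_left ?_ (by positivity)
        rw [div_le_div_iff₀ (by positivity) hS0, one_mul]
        exact mul_le_mul (e2.trans e1) (e3.trans e1) hS0.le (by positivity)
      _ = _ := by ring

theorem integral_cauchyIntegrand {κ : ℝ} (hκ : 0 < κ) {Θ : ℂ → ℂ} (hΘ : IsAiryLike Θ) {z : ℝ}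
    (hz : 0 < z) : ∫ t, cauchyIntegrand κ Θ z t = 2 * Real.pi * gaussAiry κ Θ z := by
  have hpow : Tendsto (fun S : ℝ => S ^ 4) atTop atTop := tendsto_pow_atTop (by norm_num)
  have h1 := intervalIntegral_tendsto_integral
    ((integrable_cauchyIntegrand hκ hΘ hz).mul_const I) (tendsto_neg_atTop_atBot.comp hpow) hpow
  obtain ⟨K, hK⟩ := eventually_norm_integral_cauchyIntegrand_le hκ hΘ hz
  have h2 : Tendsto (fun S : ℝ => ∫ t in (-S ^ 4)..(S ^ 4), cauchyIntegrand κ Θ z t * I) atTop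
      (𝓝 (2 * Real.pi * I * gaussAiry κ Θ z)) := by
    rw [tendsto_iff_norm_sub_tendsto_zero]
    exact squeeze_zero' (Eventually.of_forall fun _ => norm_nonneg _) hK
      (tendsto_const_nhds.div_atTop tendsto_id)
  have h3 := tendsto_nhds_unique h1 h2
  rw [integral_mul_const] at h3
  refine mul_right_cancel₀ I_ne_zero (h3.trans ?_)
  ring

theorem hasSum_expansionCoeff_ofReal {κ : ℝ} (hκ : 0 < κ) {Θ : ℂ → ℂ} (hΘ : IsAiryLike Θ) {z : ℝ}
    (hz : 0 < z) : HasSum (fun n => expansionCoeff κ Θ n z * gam z ^ n) (gaussAiry κ Θ z) := by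
  obtain ⟨M, hM, h⟩ := norm_expansionKernel_mul_le hκ hΘ (z : ℂ)
  have hg := norm_gam_ofReal_le hz
  have hw : ∀ t : ℝ, 3 ≤ (((3 : ℝ) : ℂ) + t * I).re := by simp
  have he : 7 * Real.exp (-3) ≤ 1 / 2 := by
    have : (14 : ℝ) ≤ Real.exp 3 := by
      have : (14 : ℝ) ≤ Real.exp 1 ^ 3 := by
        have := Real.exp_one_gt_d9
        calc (14 : ℝ) ≤ 2.7182818283 ^ 3 := by norm_num
          _ ≤ _ := by gcongr
      rw [← Real.exp_nat_mul] at this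
      norm_num at this
      exact this
    rw [Real.exp_neg, ← div_eq_mul_inv, div_le_iff₀ (by positivity)]
    linarith
  have hsum := hasSum_integral_of_summable_integral_norm (μ := volume)
    (F := fun (n : ℕ) (t : ℝ) => expansionKernel κ Θ n z ((3 : ℝ) + t * I) * gam z ^ n)
    (fun n => (integrable_expansionKernel hκ hΘ n z).mul_const _) ?_
  · have hpt : ∀ t : ℝ, ∑' n : ℕ, expansionKernel κ Θ n z ((3 : ℝ) + t * I) * gam z ^ n =
        cauchyIntegrand κ Θ z t := by
      intro t
      have hr := two_le_norm_gam_ratio (hw t) hg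
      have hgam := gam_ctr_ne_zero (hw t)
      have hne : gam (ctr ((3 : ℝ) + t * I)) - gam z ≠ 0 := by
        intro h0
        have := hr.1
        rw [h0, norm_zero, mul_zero] at this
        exact hgam (norm_le_zero_iff.mp this)
      have hgeo := (hasSum_geometric_of_norm_lt_one
        (lt_of_le_of_lt hr.2 (by norm_num : (1 / 2 : ℝ) < 1))).mul_left
          (expansionKernel κ Θ 0 z ((3 : ℝ) + t * I))
      rw [cauchyIntegrand, gaussAiry_div_eq κ Θ (hw t) hg]
      have e1 : (1 - gam z / gam (ctr ((3 : ℝ) + t * I)))⁻¹ =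
          gam (ctr ((3 : ℝ) + t * I)) / (gam (ctr ((3 : ℝ) + t * I)) - gam z) := by
        rw [one_sub_div hgam, inv_div]
      rw [← e1, ← hgeo.tsum_eq]
      congr 1
      ext n
      simp only [expansionKernel]
      rw [div_pow, zero_add, pow_one, pow_succ]
      field_simp
    simp_rw [hpt, integral_cauchyIntegrand hκ hΘ hz, integral_mul_const] at hsum
    have := hsum.mul_left (2 * Real.pi : ℂ)⁻¹
    rw [inv_mul_cancel_left₀ (by simp [Real.pi_ne_zero])] at this
    simpa only [expansionCoeff, mul_assoc] using this
  · refine Summable.of_nonneg_of_le (fun n => integral_nonneg fun t => norm_nonneg _) (fun n => ?_)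
      ((summable_geometric_of_lt_one (by norm_num) (by norm_num : (1 / 2 : ℝ) < 1)).mul_left
        (∫ t : ℝ, M / (1 + t ^ 2)))
    rw [← integral_mul_const]
    refine integral_mono_of_nonneg (Eventually.of_forall fun t => norm_nonneg _)
      ((integrable_const_div_one_add_sq M).mul_const _) (Eventually.of_forall fun t => ?_)
    simp only [norm_mul, norm_pow]
    calc _ ≤ M * Real.exp (-3) ^ n / (1 + t ^ 2) * 7 ^ n := by gcongr; exact h n t
      _ = M / (1 + t ^ 2) * (7 * Real.exp (-3)) ^ n := by rw [mul_pow]; ring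
      _ ≤ _ := by gcongr

theorem IsFactorialDecay.norm_mul_pow_le {ψ : ℕ → ℂ → ℂ} {K A : ℝ} (hK : 0 < K) (hA : 0 < A)
    (h : ∀ n z, ‖ψ n z‖ ≤
      K * A ^ n / (n.factorial : ℝ) ^ (3 / 2 : ℝ) * Real.exp (‖z‖ ^ (2 / 3 : ℝ)))
    {R G : ℝ} {z y : ℂ} (hz : ‖z‖ ≤ R) (hy : ‖y‖ ≤ G) (n : ℕ) :
    ‖ψ n z * y ^ n‖ ≤ K * Real.exp (R ^ (2 / 3 : ℝ)) * ((A * G) ^ n / n.factorial) := by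
  have h1 : (n.factorial : ℝ) ≤ (n.factorial : ℝ) ^ (3 / 2 : ℝ) :=
    Real.self_le_rpow_of_one_le (by exact_mod_cast n.factorial_pos) (by norm_num)
  have h2 : (0 : ℝ) < n.factorial := by exact_mod_cast n.factorial_pos
  have h3 : ‖z‖ ^ (2 / 3 : ℝ) ≤ R ^ (2 / 3 : ℝ) :=
    Real.rpow_le_rpow (norm_nonneg z) hz (by norm_num)
  have hG : 0 ≤ G := (norm_nonneg y).trans hy
  rw [norm_mul, norm_pow]
  calc _ ≤ (K * A ^ n / (n.factorial : ℝ) ^ (3 / 2 : ℝ) * Real.exp (‖z‖ ^ (2 / 3 : ℝ))) *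
        ‖y‖ ^ n := by gcongr; exact h n z
    _ ≤ (K * A ^ n / (n.factorial : ℝ) * Real.exp (R ^ (2 / 3 : ℝ))) * G ^ n := by
      gcongr ?_ * ?_
      · exact mul_le_mul (div_le_div_of_nonneg_left (by positivity) h2 h1)
          (Real.exp_le_exp.mpr h3) (Real.exp_pos _).le (by positivity)
      · gcongr
    _ = _ := by rw [mul_pow]; ring

theorem IsFactorialDecay.differentiable_tsum {ψ : ℕ → ℂ → ℂ} (hψ : IsFactorialDecay ψ) {g : ℂ → ℂ}
    (hg : Differentiable ℂ g) : Differentiable ℂ fun z => ∑' n, ψ n z * g z ^ n := by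
  obtain ⟨K, A, hK, hA, h⟩ := hψ.bound
  intro z
  obtain ⟨G, hG⟩ := (isCompact_closedBall (0 : ℂ) (‖z‖ + 1)).exists_bound_of_continuousOn
    hg.continuous.continuousOn
  have := differentiableOn_tsum_of_summable_norm (U := Metric.ball (0 : ℂ) (‖z‖ + 1))
    (F := fun n z => ψ n z * g z ^ n)
    ((Real.summable_pow_div_factorial (A * G)).mul_left
      (K * Real.exp ((‖z‖ + 1) ^ (2 / 3 : ℝ))))
    (fun n => ((hψ.differentiable n).mul (hg.pow n)).differentiableOn) Metric.isOpen_ball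
    (fun n w hw => ?_)
  · exact this.differentiableAt (Metric.isOpen_ball.mem_nhds (by simp))
  · exact norm_mul_pow_le hK hA h (by simpa using (Metric.mem_ball.mp hw).le)
      (hG w (Metric.ball_subset_closedBall hw)) n

theorem tsum_expansionCoeff {κ : ℝ} (hκ : 0 < κ) {Θ : ℂ → ℂ} (hΘ : IsAiryLike Θ) (z : ℂ) :
    ∑' n, expansionCoeff κ Θ n z * gam z ^ n = gaussAiry κ Θ z := by
  have h1 := (isFactorialDecay_expansionCoeff hκ hΘ).differentiable_tsum differentiable_gam
  have h2 := differentiable_gaussAiry κ hΘ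
  refine congrFun (AnalyticOnNhd.eq_of_frequently_eq (z₀ := 1)
    (fun z _ => h1.analyticAt z) (fun z _ => h2.analyticAt z) ?_) z
  have h3 : Tendsto (fun x : ℝ => (x : ℂ)) (𝓝[≠] 1) (𝓝[≠] 1) := by
    refine tendsto_nhdsWithin_iff.mpr ⟨?_, ?_⟩
    · have : Tendsto (fun x : ℝ => (x : ℂ)) (𝓝 1) (𝓝 ((1 : ℝ) : ℂ)) :=
        continuous_ofReal.tendsto 1
      rw [ofReal_one] at this
      exact this.mono_left nhdsWithin_le_nhds
    · filter_upwards [self_mem_nhdsWithin] with x hx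
      simpa using hx
  refine h3.frequently (Eventually.frequently ?_)
  have : ∀ᶠ x : ℝ in 𝓝[≠] 1, 0 < x :=
    nhdsWithin_le_nhds (lt_mem_nhds (by norm_num))
  filter_upwards [this] with x hx
  exact (hasSum_expansionCoeff_ofReal hκ hΘ hx).tsum_eq

end CauchyFormula

section GevreyBump

/-- Holomorphic germ of the bump function. -/
noncomputable def bumpGerm (z : ℂ) : ℂ := exp (-(1 / z ^ 3) - 1 / (1 - z) ^ 3)

theorem differentiableAt_bumpGerm {z : ℂ} (h0 : z ≠ 0) (h1 : z ≠ 1) :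
    DifferentiableAt ℂ bumpGerm z := by
  have h2 : z ^ 3 ≠ 0 := pow_ne_zero _ h0
  have h3 : (1 - z) ^ 3 ≠ 0 := pow_ne_zero _ (sub_ne_zero.mpr h1.symm)
  unfold bumpGerm
  have h4 : DifferentiableAt ℂ (fun z : ℂ => 1 / z ^ 3) z :=
    (differentiableAt_const _).div (by fun_prop) h2
  have h5 : DifferentiableAt ℂ (fun z : ℂ => 1 / (1 - z) ^ 3) z :=
    (differentiableAt_const _).div (by fun_prop) h3
  exact (h4.neg.sub h5).cexp

theorem half_le_re_one_div_pow_three {x : ℝ} (hx : 0 < x) {z : ℂ} (hz : ‖z - x‖ ≤ x / 20) :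
    (1 / 2) * (1 / x) ^ 3 ≤ (1 / z ^ 3).re := by
  set w : ℂ := z / x - 1 with hw
  have hx0 : (x : ℂ) ≠ 0 := by exact_mod_cast hx.ne'
  have hzw : z = x * (1 + w) := by rw [hw]; field_simp; ring
  have hwn : ‖w‖ ≤ 1 / 20 := by
    have : w = (z - x) / x := by rw [hw]; field_simp
    rw [this, norm_div, norm_real, Real.norm_of_nonneg hx.le, div_le_iff₀ hx]
    linarith
  have h1 : ‖(1 + w) ^ 3 - 1‖ ≤ 0.2 := by
    have : (1 + w) ^ 3 - 1 = w * (3 + 3 * w + w * w) := by ring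
    rw [this, norm_mul]
    have : ‖3 + 3 * w + w * w‖ ≤ 3 + 3 * (1 / 20) + (1 / 20) * (1 / 20) := by
      refine (norm_add_le _ _).trans (add_le_add ((norm_add_le _ _).trans (add_le_add ?_ ?_)) ?_)
      · simp
      · rw [norm_mul]; simpa using hwn
      · rw [norm_mul]; gcongr
    calc _ ≤ (1 / 20) * (3 + 3 * (1 / 20) + (1 / 20) * (1 / 20) : ℝ) := by gcongr
      _ ≤ _ := by norm_num
  have h2 : 0.8 ≤ ‖(1 + w) ^ 3‖ := by
    have := norm_sub_norm_le (1 : ℂ) (1 - (1 + w) ^ 3)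
    rw [sub_sub_cancel, norm_one, norm_sub_rev] at this
    norm_num at h1 this ⊢
    linarith
  have h3 : ‖1 / (1 + w) ^ 3 - 1‖ ≤ 1 / 2 := by
    have hne : (1 + w) ^ 3 ≠ 0 := norm_pos_iff.mp (lt_of_lt_of_le (by norm_num) h2)
    rw [div_sub_one hne, norm_div, norm_sub_rev, div_le_iff₀ (norm_pos_iff.mpr hne)]
    norm_num at h1 h2 ⊢
    linarith
  have h4 : 1 / 2 ≤ (1 / (1 + w) ^ 3).re := by
    have := (abs_re_le_norm (1 / (1 + w) ^ 3 - 1)).trans h3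
    rw [sub_re, one_re] at this
    linarith [(abs_le.mp this).1]
  have h5 : 1 / z ^ 3 = (((1 / x) ^ 3 : ℝ) : ℂ) * (1 / (1 + w) ^ 3) := by
    rw [hzw, mul_pow]; push_cast; field_simp
  rw [h5, re_ofReal_mul, mul_comm]
  gcongr

theorem norm_bumpGerm_le {x m : ℝ} (hm : 0 < m) (h0 : m ≤ x) (h1 : m ≤ 1 - x) {z : ℂ}
    (hz : ‖z - x‖ ≤ m / 20) : ‖bumpGerm z‖ ≤ Real.exp (-((1 / 2) * (1 / x) ^ 3)) ∧
      ‖bumpGerm z‖ ≤ Real.exp (-((1 / 2) * (1 / (1 - x)) ^ 3)) := by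
  have hx : 0 < x := by linarith
  have hx1 : 0 < 1 - x := by linarith
  have h2 := half_le_re_one_div_pow_three hx (z := z) (by linarith)
  have h3 := half_le_re_one_div_pow_three hx1 (z := 1 - z) (by
    rw [norm_sub_rev]
    push_cast
    rw [sub_sub_sub_cancel_left]
    linarith)
  have h4 : 0 ≤ (1 / 2) * (1 / x) ^ 3 := by positivity
  have h5 : 0 ≤ (1 / 2) * (1 / (1 - x)) ^ 3 := by positivity
  rw [bumpGerm, norm_exp, sub_re, neg_re, Real.exp_le_exp, Real.exp_le_exp]
  constructor <;> linarith

theorem norm_iteratedDeriv_bumpGerm_le {x m : ℝ} (hm : 0 < m) (h0 : m ≤ x) (h1 : m ≤ 1 - x)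
    (hmm : x = m ∨ 1 - x = m) (j : ℕ) :
    ‖iteratedDeriv j bumpGerm x‖ ≤
      j.factorial * 20 ^ j * ((1 / m) ^ j * Real.exp (-((1 / 2) * (1 / m) ^ 3))) := by
  have hx : 0 < x := by linarith
  have hd : ∀ z ∈ Metric.closedBall (x : ℂ) (m / 20), DifferentiableAt ℂ bumpGerm z := by
    intro z hz
    rw [mem_closedBall_iff_norm] at hz
    refine differentiableAt_bumpGerm ?_ ?_
    · rintro rfl
      rw [zero_sub, norm_neg, norm_real, Real.norm_of_nonneg hx.le] at hz
      linarith
    · rintro rfl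
      rw [← ofReal_one, ← ofReal_sub, norm_real, Real.norm_of_nonneg (by linarith)] at hz
      linarith
  have := norm_iteratedDeriv_le_of_forall_mem_sphere_norm_le j (f := bumpGerm) (c := x)
    (R := m / 20) (C := Real.exp (-((1 / 2) * (1 / m) ^ 3))) (by positivity)
    (DifferentiableOn.diffContOnCl_ball (U := Metric.closedBall (x : ℂ) (m / 20))
      (fun z hz => (hd z hz).differentiableWithinAt) le_rfl) (fun z hz => ?_)
  · refine this.trans (le_of_eq ?_)
    rw [div_pow m, one_div_pow m j]
    field_simp
  · have h2 := norm_bumpGerm_le hm h0 h1 (mem_sphere_iff_norm.mp hz).le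
    rcases hmm with h | h
    · rw [← h]; exact h2.1
    · rw [← h]; exact h2.2

open Classical in
/-- Derivatives of a Gevrey bump function supported in the unit interval. -/
noncomputable def bump (j : ℕ) (x : ℝ) : ℂ :=
  if 0 < x ∧ x < 1 then iteratedDeriv j bumpGerm x else 0

theorem bump_of_notMem {j : ℕ} {x : ℝ} (hx : ¬(0 < x ∧ x < 1)) : bump j x = 0 := if_neg hx

theorem norm_bump_le {x : ℝ} (hx : 0 < x ∧ x < 1) (j : ℕ) : ‖bump j x‖ ≤
    j.factorial * 20 ^ j * ((1 / min x (1 - x)) ^ j *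
      Real.exp (-((1 / 2) * (1 / min x (1 - x)) ^ 3))) := by
  rw [bump, if_pos hx]
  refine norm_iteratedDeriv_bumpGerm_le (lt_min hx.1 (by linarith [hx.2])) (min_le_left _ _)
    (min_le_right _ _) ?_ j
  rcases min_choice x (1 - x) with h | h
  · exact Or.inl h.symm
  · exact Or.inr h.symm

theorem pow_mul_exp_neg_le {u : ℝ} (hu : 0 < u) (j : ℕ) :
    u ^ j * Real.exp (-((1 / 2) * u ^ 3)) ≤ 2 ^ j * (j.factorial : ℝ) ^ (1 / 3 : ℝ) := by
  have hj : (0 : ℝ) < j.factorial := by exact_mod_cast j.factorial_pos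
  have h1 : (u ^ 3 / 2) ^ j / j.factorial ≤ Real.exp (u ^ 3 / 2) :=
    Real.pow_div_factorial_le_exp _ (by positivity) j
  rw [div_le_iff₀ hj] at h1
  refine le_of_pow_le_pow_left₀ (n := 3) (by norm_num) (by positivity) ?_
  have e1 : ((j.factorial : ℝ) ^ (1 / 3 : ℝ)) ^ 3 = j.factorial := by
    rw [← Real.rpow_natCast, ← Real.rpow_mul hj.le]; norm_num
  have e2 : Real.exp (-((1 / 2) * u ^ 3)) ^ 3 * Real.exp (u ^ 3 / 2) ≤ 1 := by
    rw [← Real.exp_nat_mul, ← Real.exp_add, Real.exp_le_one_iff]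
    have : 0 < u ^ 3 := by positivity
    push_cast; linarith
  have e3 : (1 : ℝ) ≤ 2 ^ j := one_le_pow₀ (by norm_num)
  calc (u ^ j * Real.exp (-((1 / 2) * u ^ 3))) ^ 3
      = 2 ^ j * Real.exp (-((1 / 2) * u ^ 3)) ^ 3 * (u ^ 3 / 2) ^ j := by
        rw [div_pow]; field_simp; ring
    _ ≤ 2 ^ j * Real.exp (-((1 / 2) * u ^ 3)) ^ 3 * (Real.exp (u ^ 3 / 2) * j.factorial) := by
        gcongr
    _ = 2 ^ j * j.factorial * (Real.exp (-((1 / 2) * u ^ 3)) ^ 3 * Real.exp (u ^ 3 / 2)) := by ring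
    _ ≤ 2 ^ j * j.factorial * 1 := by gcongr
    _ ≤ (2 ^ j) ^ 3 * j.factorial := by
        rw [mul_one]
        gcongr
        exact le_self_pow₀ e3 (by norm_num)
    _ = _ := by rw [mul_pow, e1]

theorem norm_bump_le_factorial (j : ℕ) (x : ℝ) :
    ‖bump j x‖ ≤ 40 ^ j * (j.factorial : ℝ) ^ (4 / 3 : ℝ) := by
  by_cases hx : 0 < x ∧ x < 1
  · have hm : 0 < 1 / min x (1 - x) := one_div_pos.mpr (lt_min hx.1 (by linarith [hx.2]))
    have hj : (0 : ℝ) < j.factorial := by exact_mod_cast j.factorial_pos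
    calc _ ≤ _ := norm_bump_le hx j
      _ ≤ j.factorial * 20 ^ j * (2 ^ j * (j.factorial : ℝ) ^ (1 / 3 : ℝ)) :=
        mul_le_mul_of_nonneg_left (pow_mul_exp_neg_le hm j) (by positivity)
      _ = _ := by
        rw [show (4 / 3 : ℝ) = 1 + 1 / 3 by norm_num, Real.rpow_add hj, Real.rpow_one,
          show (40 : ℝ) = 20 * 2 by norm_num, mul_pow]
        ring
  · rw [bump_of_notMem hx, norm_zero]; positivity

theorem exists_norm_bump_le_sq (j : ℕ) : ∃ K : ℝ, 0 ≤ K ∧ ∀ x y : ℝ, ¬(0 < x ∧ x < 1) →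
    ‖bump j y‖ ≤ K * (y - x) ^ 2 := by
  refine ⟨j.factorial * 20 ^ j * (2 ^ (j + 2) * ((j + 2).factorial : ℝ) ^ (1 / 3 : ℝ)),
    by positivity, fun x y hx => ?_⟩
  by_cases hy : 0 < y ∧ y < 1
  · set m := min y (1 - y) with hm
    have hm0 : 0 < m := lt_min hy.1 (by linarith [hy.2])
    have h1 := pow_mul_exp_neg_le (one_div_pos.mpr hm0) (j + 2)
    have h2 : m ^ 2 ≤ (y - x) ^ 2 := by
      rw [sq_le_sq, abs_of_pos hm0]
      rcases not_and_or.mp hx with h | h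
      · exact (min_le_left _ _).trans ((by linarith : y ≤ y - x).trans (le_abs_self _))
      · exact (min_le_right _ _).trans ((by linarith : 1 - y ≤ -(y - x)).trans (neg_le_abs _))
    have h3 : (1 / m) ^ j * Real.exp (-((1 / 2) * (1 / m) ^ 3)) =
        ((1 / m) ^ (j + 2) * Real.exp (-((1 / 2) * (1 / m) ^ 3))) * m ^ 2 := by
      rw [pow_add]; field_simp
    refine (norm_bump_le hy j).trans ?_
    rw [← hm, h3, mul_assoc (_ * _)]
    gcongr
  · rw [bump_of_notMem hy, norm_zero]; positivity

theorem hasDerivAt_bump (j : ℕ) (x : ℝ) : HasDerivAt (bump j) (bump (j + 1) x) x := by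
  by_cases hx : 0 < x ∧ x < 1
  · have hU : IsOpen ({0, 1}ᶜ : Set ℂ) := (Set.toFinite _).isClosed.isOpen_compl
    have hd : DifferentiableOn ℂ bumpGerm {0, 1}ᶜ := fun z hz => by
      simp only [mem_compl_iff, mem_insert_iff, mem_singleton_iff, not_or] at hz
      exact (differentiableAt_bumpGerm hz.1 hz.2).differentiableWithinAt
    have hmem : (x : ℂ) ∈ ({0, 1}ᶜ : Set ℂ) := by
      simp only [mem_compl_iff, mem_insert_iff, mem_singleton_iff, not_or]
      exact ⟨by exact_mod_cast hx.1.ne', by exact_mod_cast hx.2.ne⟩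
    have h1 : DifferentiableAt ℂ (iteratedDeriv j bumpGerm) x := by
      have han : AnalyticAt ℂ bumpGerm x := hd.analyticAt (hU.mem_nhds hmem)
      rw [iteratedDeriv_eq_iterate]
      exact (han.iterated_deriv j).differentiableAt
    have h2 := h1.hasDerivAt.comp_ofReal
    rw [← iteratedDeriv_succ] at h2
    rw [bump, if_pos hx]
    refine h2.congr_of_eventuallyEq ?_
    filter_upwards [Ioo_mem_nhds hx.1 hx.2] with y hy
    exact if_pos hy
  · obtain ⟨K, hK, h⟩ := exists_norm_bump_le_sq j
    rw [bump_of_notMem hx, hasDerivAt_iff_isLittleO]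
    refine Asymptotics.IsBigO.trans_isLittleO (g := fun y => ‖y - x‖ ^ 2) ?_
      (Asymptotics.isLittleO_pow_sub_sub x one_lt_two)
    refine Asymptotics.IsBigO.of_bound K (Eventually.of_forall fun y => ?_)
    rw [bump_of_notMem hx, smul_zero, sub_zero, sub_zero, norm_pow, norm_norm,
      Real.norm_eq_abs, sq_abs]
    exact h x y hx

theorem continuous_bump (j : ℕ) : Continuous (bump j) :=
  continuous_iff_continuousAt.mpr fun x => (hasDerivAt_bump j x).continuousAt

theorem hasCompactSupport_bump (j : ℕ) : HasCompactSupport (bump j) :=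
  HasCompactSupport.intro (isCompact_Icc (a := 0) (b := 1)) fun _ hx =>
    bump_of_notMem fun h => hx ⟨h.1.le, h.2.le⟩

/-- Bilateral Laplace transform of the bump function. -/
noncomputable def bumpLaplace (z : ℂ) : ℂ := ∫ x : ℝ, bump 0 x * exp (z * x)

theorem integrable_bump_mul_exp (j : ℕ) (z : ℂ) : Integrable fun x : ℝ => bump j x * exp (z * x) :=
  ((continuous_bump j).mul (by fun_prop)).integrable_of_hasCompactSupport
    ((hasCompactSupport_bump j).mul_right)

theorem integral_bump_mul_exp (j : ℕ) (z : ℂ) :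
    ∫ x : ℝ, bump j x * exp (z * x) = (-z) ^ j * bumpLaplace z := by
  induction j with
  | zero => simp [bumpLaplace]
  | succ j ih =>
    have h1 : ∀ x : ℝ, HasDerivAt (fun x : ℝ => bump j x * exp (z * x))
        (bump (j + 1) x * exp (z * x) + z * (bump j x * exp (z * x))) x := by
      intro x
      have h2 : HasDerivAt (fun x : ℝ => exp (z * x)) (exp (z * x) * (z * 1)) x :=
        ((hasDerivAt_id (x : ℂ)).const_mul z).cexp.comp_ofReal
      refine HasDerivAt.congr_deriv (f := fun x : ℝ => bump j x * exp (z * x))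
        ((hasDerivAt_bump j x).mul h2) ?_
      ring
    have h3 := integral_eq_zero_of_hasDerivAt_of_integrable h1
      ((integrable_bump_mul_exp (j + 1) z).add ((integrable_bump_mul_exp j z).const_mul z))
      (integrable_bump_mul_exp j z)
    rw [integral_add (integrable_bump_mul_exp (j + 1) z)
      ((integrable_bump_mul_exp j z).const_mul z), integral_const_mul, ih] at h3
    rw [eq_neg_of_add_eq_zero_left h3]
    ring

theorem norm_bump_mul_exp_le (x : ℝ) (z : ℂ) :
    ‖bump 0 x * exp (z * x)‖ ≤ ‖bump 0 x‖ * Real.exp ‖z‖ := by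
  rw [norm_mul]
  by_cases hx : 0 < x ∧ x < 1
  · refine mul_le_mul_of_nonneg_left ?_ (norm_nonneg _)
    refine (norm_exp_le_exp_norm _).trans (Real.exp_le_exp.mpr ?_)
    rw [norm_mul, norm_real, Real.norm_of_nonneg hx.1.le]
    exact mul_le_of_le_one_right (norm_nonneg _) hx.2.le
  · rw [bump_of_notMem hx]; simp

theorem integrable_norm_bump : Integrable fun x => ‖bump 0 x‖ :=
  ((continuous_bump 0).integrable_of_hasCompactSupport (hasCompactSupport_bump 0)).norm

theorem differentiable_bumpLaplace : Differentiable ℂ bumpLaplace := by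
  refine differentiable_integral_param
    (fun z => (integrable_bump_mul_exp 0 z).aestronglyMeasurable) (fun x => by fun_prop)
    fun R => ⟨fun x => ‖bump 0 x‖ * Real.exp R, integrable_norm_bump.mul_const _, fun x z hz => ?_⟩
  refine (norm_bump_mul_exp_le x z).trans ?_
  exact mul_le_mul_of_nonneg_left (Real.exp_le_exp.mpr hz) (norm_nonneg _)

theorem exists_norm_bumpLaplace_le : ∃ C : ℝ, 0 ≤ C ∧ ∀ z, ‖bumpLaplace z‖ ≤ C * Real.exp ‖z‖ := by
  refine ⟨∫ x, ‖bump 0 x‖, integral_nonneg fun _ => norm_nonneg _, fun z => ?_⟩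
  rw [← integral_mul_const]
  exact norm_integral_le_of_norm_le (integrable_norm_bump.mul_const _)
    (Eventually.of_forall fun x => norm_bump_mul_exp_le x z)

theorem bumpLaplace_zero_ne_zero : bumpLaplace 0 ≠ 0 := by
  have h1 : ∀ x : ℝ, bump 0 x = ((‖bump 0 x‖ : ℝ) : ℂ) := by
    intro x
    by_cases hx : 0 < x ∧ x < 1
    · rw [bump, if_pos hx, iteratedDeriv_zero, bumpGerm]
      have : -(1 / (x : ℂ) ^ 3) - 1 / (1 - (x : ℂ)) ^ 3 =
          ((-(1 / x ^ 3) - 1 / (1 - x) ^ 3 : ℝ) : ℂ) := by push_cast; ring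
      rw [this, ← ofReal_exp, norm_real, Real.norm_of_nonneg (Real.exp_pos _).le]
    · simp [bump_of_notMem hx]
  have h2 : 0 < ∫ x, ‖bump 0 x‖ := by
    refine (continuous_bump 0).norm.integral_pos_of_hasCompactSupport_nonneg_nonzero
      (hasCompactSupport_bump 0).norm (fun x => norm_nonneg _) (x := 1 / 2) ?_
    rw [bump, if_pos (by norm_num), iteratedDeriv_zero, bumpGerm]
    exact norm_ne_zero_iff.mpr (exp_ne_zero _)
  rw [bumpLaplace]
  simp only [zero_mul, exp_zero, mul_one]
  have h3 : ∫ x, bump 0 x = ((∫ x, ‖bump 0 x‖ : ℝ) : ℂ) := by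
    rw [← integral_complex_ofReal]
    exact integral_congr_ae (Eventually.of_forall h1)
  rw [h3]
  exact_mod_cast h2.ne'

end GevreyBump

section EntireSymbol

/-- Rescaling of `bump` to the interval `[0, ε]`, normalized as derivatives of one function. -/
noncomputable def scaledBump (ε : ℝ) (j : ℕ) (s : ℝ) : ℂ := (ε : ℂ)⁻¹ ^ j * bump j (s / ε)

theorem continuous_scaledBump (ε : ℝ) (j : ℕ) : Continuous (scaledBump ε j) :=
  continuous_const.mul ((continuous_bump j).comp (by fun_prop))

theorem scaledBump_of_notMem {ε : ℝ} (hε : 0 < ε) (j : ℕ) {s : ℝ} (hs : s ∉ Icc 0 ε) :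
    scaledBump ε j s = 0 := by
  rw [scaledBump, bump_of_notMem, mul_zero]
  rintro ⟨h1, h2⟩
  rw [div_lt_one hε] at h2
  exact hs ⟨((div_pos_iff_of_pos_right hε).mp h1).le, h2.le⟩

theorem norm_scaledBump_le {ε : ℝ} (hε : 0 < ε) (j : ℕ) (s : ℝ) :
    ‖scaledBump ε j s‖ ≤ (40 / ε) ^ j * (j.factorial : ℝ) ^ (4 / 3 : ℝ) := by
  rw [scaledBump, norm_mul, norm_pow, norm_inv, norm_real, Real.norm_of_nonneg hε.le]
  calc _ ≤ ε⁻¹ ^ j * (40 ^ j * (j.factorial : ℝ) ^ (4 / 3 : ℝ)) := by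
        gcongr; exact norm_bump_le_factorial j _
    _ = _ := by rw [div_eq_mul_inv 40 ε, mul_pow]; ring

theorem integral_scaledBump_mul_exp {ε : ℝ} (hε : 0 < ε) (j : ℕ) (z : ℂ) :
    ∫ s : ℝ, scaledBump ε j s * exp (z * s) = ε * ((-z) ^ j * bumpLaplace (ε * z)) := by
  have hε0 : (ε : ℂ) ≠ 0 := by exact_mod_cast hε.ne'
  have h1 : ∀ s : ℝ, scaledBump ε j s * exp (z * s) =
      (fun x : ℝ => (ε : ℂ)⁻¹ ^ j * (bump j x * exp (ε * z * x))) (s / ε) := by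
    intro s
    simp only [scaledBump]
    have : (ε : ℂ) * z * ((s / ε : ℝ) : ℂ) = z * s := by push_cast; field_simp
    rw [this]; ring
  rw [integral_congr_ae (Eventually.of_forall h1), Measure.integral_comp_div
    (fun x : ℝ => (ε : ℂ)⁻¹ ^ j * (bump j x * exp (ε * z * x))) ε, abs_of_pos hε,
    integral_const_mul, integral_bump_mul_exp, real_smul]
  rw [← mul_assoc ((ε : ℂ)⁻¹ ^ j), ← mul_pow]
  congr 4
  field_simp

/-- Summable majorant `C ^ n / (n !) ^ (1 / 6)`. -/
theorem summable_pow_div_factorial_rpow {C : ℝ} (hC : 0 < C) :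
    Summable fun n : ℕ => C ^ n / (n.factorial : ℝ) ^ (1 / 6 : ℝ) := by
  refine Summable.of_nonneg_of_le (fun n => by positivity) (fun n => ?_)
    ((summable_geometric_of_lt_one (by norm_num) (by norm_num : (1 / 2 : ℝ) < 1)).mul_left
      (Real.exp ((2 * C) ^ 6)))
  have hn : (0 : ℝ) < n.factorial := by exact_mod_cast n.factorial_pos
  have h1 := Real.pow_div_factorial_le_exp ((2 * C) ^ 6) (by positivity) n
  rw [div_le_iff₀ hn] at h1
  have h2 : (2 * C) ^ n ≤ Real.exp ((2 * C) ^ 6) * (n.factorial : ℝ) ^ (1 / 6 : ℝ) := by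
    refine le_of_pow_le_pow_left₀ (n := 6) (by norm_num) (by positivity) ?_
    have e1 : ((n.factorial : ℝ) ^ (1 / 6 : ℝ)) ^ 6 = n.factorial := by
      rw [← Real.rpow_natCast, ← Real.rpow_mul hn.le]; norm_num
    have e2 : Real.exp ((2 * C) ^ 6) ≤ Real.exp ((2 * C) ^ 6) ^ 6 :=
      le_self_pow₀ (Real.one_le_exp (by positivity)) (by norm_num)
    rw [mul_pow (Real.exp _), e1, ← pow_mul, mul_comm n 6, pow_mul]
    exact h1.trans (by gcongr)
  rw [div_le_iff₀ (by positivity)]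
  calc C ^ n = (1 / 2) ^ n * (2 * C) ^ n := by rw [← mul_pow]; congr 1; ring
    _ ≤ (1 / 2) ^ n * (Real.exp ((2 * C) ^ 6) * (n.factorial : ℝ) ^ (1 / 6 : ℝ)) := by gcongr
    _ = _ := by ring

/-- Terms of the test function realizing the symbol `∑ ψ n z₁ * z₂ ^ n`. -/
noncomputable def symbolTerm (ψ : ℕ → ℂ → ℂ) (ε : ℝ) (p : ℕ × ℕ) (s : ℝ × ℝ) : ℂ :=
  (-1) ^ (p.1 + p.2) * coeff (ψ p.1) p.2 * (scaledBump ε p.2 s.1 * scaledBump ε p.1 s.2)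

theorem continuous_symbolTerm (ψ : ℕ → ℂ → ℂ) (ε : ℝ) (p : ℕ × ℕ) :
    Continuous (symbolTerm ψ ε p) :=
  continuous_const.mul (((continuous_scaledBump ε p.2).comp continuous_fst).mul
    ((continuous_scaledBump ε p.1).comp continuous_snd))

theorem symbolTerm_of_notMem (ψ : ℕ → ℂ → ℂ) {ε : ℝ} (hε : 0 < ε) (p : ℕ × ℕ) {s : ℝ × ℝ}
    (hs : s ∉ Icc 0 ε ×ˢ Icc 0 ε) : symbolTerm ψ ε p s = 0 := by
  rw [symbolTerm]
  rw [mem_prod, not_and_or] at hs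
  rcases hs with h | h
  · rw [scaledBump_of_notMem hε _ h]; ring
  · rw [scaledBump_of_notMem hε _ h]; ring

theorem IsFactorialDecay.exists_norm_symbolTerm_le {ψ : ℕ → ℂ → ℂ} (hψ : IsFactorialDecay ψ)
    {ε : ℝ} (hε : 0 < ε) : ∃ u : ℕ × ℕ → ℝ, Summable u ∧ ∀ p s, ‖symbolTerm ψ ε p s‖ ≤ u p := by
  obtain ⟨K, A, hK, hA, h⟩ := hψ.bound
  refine ⟨fun p => (K * ((A * (40 / ε)) ^ p.1 / (p.1.factorial : ℝ) ^ (1 / 6 : ℝ))) *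
      ((Real.exp 1 * (40 / ε)) ^ p.2 / (p.2.factorial : ℝ) ^ (1 / 6 : ℝ)), ?_, fun p s => ?_⟩
  · have h1 := (summable_pow_div_factorial_rpow (C := A * (40 / ε)) (by positivity)).mul_left K
    have h2 := summable_pow_div_factorial_rpow (C := Real.exp 1 * (40 / ε)) (by positivity)
    exact h1.mul_of_nonneg h2 (fun n => by dsimp; positivity) (fun n => by dsimp; positivity)
  · obtain ⟨n, m⟩ := p
    have hn : (0 : ℝ) < n.factorial := by exact_mod_cast n.factorial_pos
    have hm : (0 : ℝ) < m.factorial := by exact_mod_cast m.factorial_pos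
    have h1 := norm_coeff_le (hψ.differentiable n) (h n) m
    have h2 := norm_scaledBump_le hε m s.1
    have h3 := norm_scaledBump_le hε n s.2
    have key : ∀ x : ℝ, 0 < x →
        x ^ (4 / 3 : ℝ) / x ^ (3 / 2 : ℝ) = 1 / x ^ (1 / 6 : ℝ) := by
      intro x hx
      rw [div_eq_div_iff (by positivity) (by positivity), one_mul, ← Real.rpow_add hx]
      norm_num
    rw [symbolTerm, norm_mul, norm_mul, norm_mul, norm_pow, norm_neg, norm_one, one_pow, one_mul]
    calc _ ≤ (K * A ^ n / (n.factorial : ℝ) ^ (3 / 2 : ℝ) * Real.exp 1 ^ m /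
            (m.factorial : ℝ) ^ (3 / 2 : ℝ)) *
          (((40 / ε) ^ m * (m.factorial : ℝ) ^ (4 / 3 : ℝ)) *
            ((40 / ε) ^ n * (n.factorial : ℝ) ^ (4 / 3 : ℝ))) := by gcongr
      _ = (K * (A * (40 / ε)) ^ n *
            ((n.factorial : ℝ) ^ (4 / 3 : ℝ) / (n.factorial : ℝ) ^ (3 / 2 : ℝ))) *
          ((Real.exp 1 * (40 / ε)) ^ m *
            ((m.factorial : ℝ) ^ (4 / 3 : ℝ) / (m.factorial : ℝ) ^ (3 / 2 : ℝ))) := by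
        rw [mul_pow, mul_pow]; ring
      _ = _ := by rw [key _ hn, key _ hm]; ring

theorem integral_symbolTerm (ψ : ℕ → ℂ → ℂ) {ε : ℝ} (hε : 0 < ε) (p : ℕ × ℕ) (z₁ z₂ : ℂ) :
    ∫ s : ℝ × ℝ, symbolTerm ψ ε p s * exp (z₁ * s.1 + z₂ * s.2) =
      ε ^ 2 * (bumpLaplace (ε * z₁) * bumpLaplace (ε * z₂)) *
        (coeff (ψ p.1) p.2 * z₁ ^ p.2 * z₂ ^ p.1) := by
  have h1 : ∀ s : ℝ × ℝ, symbolTerm ψ ε p s * exp (z₁ * s.1 + z₂ * s.2) =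
      ((-1) ^ (p.1 + p.2) * coeff (ψ p.1) p.2) * ((scaledBump ε p.2 s.1 * exp (z₁ * s.1)) *
        (scaledBump ε p.1 s.2 * exp (z₂ * s.2))) := by
    intro s
    rw [exp_add, symbolTerm]; ring
  rw [integral_congr_ae (Eventually.of_forall h1), integral_const_mul]
  have h2 := integral_prod_mul (μ := (volume : Measure ℝ)) (ν := (volume : Measure ℝ))
    (fun s : ℝ => scaledBump ε p.2 s * exp (z₁ * s))
    (fun s : ℝ => scaledBump ε p.1 s * exp (z₂ * s))
  rw [integral_scaledBump_mul_exp hε, integral_scaledBump_mul_exp hε, neg_pow z₁, neg_pow z₂] at h2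
  rw [Measure.volume_eq_prod, h2]
  have h3 : ((-1 : ℂ) ^ p.1) * (-1) ^ p.1 = 1 := by rw [← mul_pow]; simp
  have h4 : ((-1 : ℂ) ^ p.2) * (-1) ^ p.2 = 1 := by rw [← mul_pow]; simp
  rw [pow_add]
  linear_combination (ε ^ 2 * (bumpLaplace (ε * z₁) * bumpLaplace (ε * z₂)) *
    (coeff (ψ p.1) p.2 * z₁ ^ p.2 * z₂ ^ p.1)) * ((-1) ^ p.2 * (-1) ^ p.2 * h3 + h4)

theorem IsFactorialDecay.exists_integral_mul_exp_eq {ψ : ℕ → ℂ → ℂ} (hψ : IsFactorialDecay ψ)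
    {ε : ℝ} (hε : 0 < ε) : ∃ f : ℝ × ℝ → ℂ, Continuous f ∧ HasCompactSupport f ∧ ∀ z₁ z₂ : ℂ,
      ∫ s : ℝ × ℝ, f s * exp (z₁ * s.1 + z₂ * s.2) =
        ε ^ 2 * (bumpLaplace (ε * z₁) * bumpLaplace (ε * z₂)) * ∑' n, ψ n z₁ * z₂ ^ n := by
  obtain ⟨u, hu, hle⟩ := hψ.exists_norm_symbolTerm_le hε
  have hcpt : IsCompact (Icc 0 ε ×ˢ Icc 0 ε : Set (ℝ × ℝ)) := isCompact_Icc.prod isCompact_Icc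
  have hzero : ∀ s ∉ Icc 0 ε ×ˢ Icc 0 ε, ∑' p, symbolTerm ψ ε p s = 0 := fun s hs => by
    simp [symbolTerm_of_notMem ψ hε _ hs]
  refine ⟨fun s => ∑' p, symbolTerm ψ ε p s,
    continuous_tsum (continuous_symbolTerm ψ ε) hu hle,
    HasCompactSupport.intro hcpt hzero, fun z₁ z₂ => ?_⟩
  have hexp : Continuous fun s : ℝ × ℝ => exp (z₁ * s.1 + z₂ * s.2) := by fun_prop
  obtain ⟨G, hG⟩ := hcpt.exists_bound_of_continuousOn hexp.continuousOn
  have hind : Integrable ((Icc 0 ε ×ˢ Icc 0 ε : Set (ℝ × ℝ)).indicator fun _ => G) :=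
    (integrable_indicator_iff hcpt.measurableSet).mpr (integrableOn_const hcpt.measure_ne_top)
  have hbd : ∀ p s, ‖symbolTerm ψ ε p s * exp (z₁ * s.1 + z₂ * s.2)‖ ≤
      u p * (Icc 0 ε ×ˢ Icc 0 ε : Set (ℝ × ℝ)).indicator (fun _ => G) s := by
    intro p s
    by_cases hs : s ∈ Icc 0 ε ×ˢ Icc 0 ε
    · rw [indicator_of_mem hs, norm_mul]
      exact mul_le_mul (hle p s) (hG s hs) (norm_nonneg _) ((norm_nonneg _).trans (hle p s))
    · rw [symbolTerm_of_notMem ψ hε p hs, indicator_of_notMem hs]; simp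
  have hint : ∀ p, Integrable fun s : ℝ × ℝ => symbolTerm ψ ε p s * exp (z₁ * s.1 + z₂ * s.2) :=
    fun p => (hind.const_mul (u p)).mono'
      ((continuous_symbolTerm ψ ε p).mul hexp).aestronglyMeasurable
      (Eventually.of_forall (hbd p))
  have hsum := hasSum_integral_of_summable_integral_norm hint
    (Summable.of_nonneg_of_le (fun p => integral_nonneg fun _ => norm_nonneg _)
      (fun p => (integral_mono_of_nonneg (Eventually.of_forall fun _ => norm_nonneg _)
        (hind.const_mul (u p)) (Eventually.of_forall (hbd p))).trans_eq (integral_const_mul _ _))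
      (hu.mul_right _))
  simp_rw [integral_symbolTerm ψ hε, tsum_mul_right] at hsum
  have hfib := hsum.prod_fiberwise fun n =>
    (((hasSum_coeff (hψ.differentiable n) z₁).mul_right (z₂ ^ n)).mul_left
      (ε ^ 2 * (bumpLaplace (ε * z₁) * bumpLaplace (ε * z₂)) : ℂ))
  rw [← hfib.tsum_eq, tsum_mul_left]

end EntireSymbol

section MeanPeriodic

/-- The joint exponential `exp (p₁ √v + p₂ gam √v)`. -/
noncomputable def wave (p : ℝ × ℝ) (v : ℂ) : ℂ := exp (p.1 * csqrt v + p.2 * gam (csqrt v))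

theorem norm_gam_csqrt_le {v : ℂ} (hv : 0 < v.re) : ‖gam (csqrt v)‖ ≤ 7 :=
  norm_gam_le_seven (csqrt_re_pos hv) (by rw [csqrt_sq]; exact hv.le)

theorem norm_wave_le (p : ℝ × ℝ) {v : ℂ} (hv : 0 < v.re) :
    ‖wave p v‖ ≤ Real.exp (7 * |p.2|) * Real.exp (|p.1| * √‖v‖) := by
  rw [wave, ← Real.exp_add]
  refine (norm_exp_le_exp_norm _).trans (Real.exp_le_exp.mpr ((norm_add_le _ _).trans ?_))
  rw [norm_mul, norm_mul, norm_real, norm_real, norm_csqrt, Real.norm_eq_abs, Real.norm_eq_abs]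
  have := mul_le_mul_of_nonneg_left (norm_gam_csqrt_le hv) (abs_nonneg p.2)
  linarith

theorem wave_add (p s : ℝ × ℝ) (v : ℂ) : wave (p + s) v = wave p v * wave s v := by
  rw [wave, wave, wave, ← exp_add, Prod.fst_add, Prod.snd_add]
  congr 1
  push_cast
  ring

theorem continuous_csqrt_vertical : Continuous fun t : ℝ => csqrt ((1 : ℝ) + t * I) :=
  continuous_vertical (s := {v | 0 < v.re})
    (fun _ hv => (hasDerivAt_csqrt hv).continuousAt.continuousWithinAt) (by simp)

theorem continuous_wave_vertical :
    Continuous fun q : (ℝ × ℝ) × ℝ => wave q.1 ((1 : ℝ) + q.2 * I) := by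
  have h1 : Continuous fun q : (ℝ × ℝ) × ℝ => csqrt ((1 : ℝ) + q.2 * I) :=
    continuous_csqrt_vertical.comp continuous_snd
  have h2 := differentiable_gam.continuous.comp h1
  exact (((continuous_ofReal.comp (continuous_fst.comp continuous_fst)).mul h1).add
    ((continuous_ofReal.comp (continuous_snd.comp continuous_fst)).mul h2)).cexp

/-- Density of the superposition `meanPeriodic`. -/
noncomputable def density (κ : ℝ) (t : ℝ) : ℂ :=
  exp (κ * ((1 : ℝ) + t * I)) * weight ((1 : ℝ) + t * I)

theorem continuous_density (κ : ℝ) : Continuous (density κ) :=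
  Continuous.mul (by fun_prop) continuous_weight_vertical

theorem exists_norm_wave_mul_density_le (κ R : ℝ) : ∃ K : ℝ, ∀ p : ℝ × ℝ, ‖p‖ ≤ R → ∀ t : ℝ,
    ‖wave p ((1 : ℝ) + t * I) * density κ t‖ ≤ K / (1 + t ^ 2) := by
  obtain ⟨K, hK, h⟩ := exists_exp_mul_norm_weight_le R
  refine ⟨Real.exp (7 * R) * Real.exp κ * K, fun p hp t => ?_⟩
  have hre : ((((1 : ℝ) : ℂ) + t * I)).re = 1 := by simp
  have him : ((((1 : ℝ) : ℂ) + t * I)).im = t := by simp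
  have h1 := h ((1 : ℝ) + t * I) (by rw [hre])
  rw [hre, him, one_mul] at h1
  have hp1 : |p.1| ≤ R := (norm_fst_le p).trans hp
  have hp2 : |p.2| ≤ R := (norm_snd_le p).trans hp
  have h2 := norm_wave_le p (v := (1 : ℝ) + t * I) (by rw [hre]; exact one_pos)
  have h3 : ‖exp (κ * ((1 : ℝ) + t * I))‖ = Real.exp κ := by
    rw [norm_exp, re_ofReal_mul, hre, mul_one]
  rw [density, norm_mul, norm_mul, h3]
  calc _ ≤ (Real.exp (7 * |p.2|) * Real.exp (|p.1| * √‖((1 : ℝ) + t * I : ℂ)‖)) *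
        (Real.exp κ * ‖weight ((1 : ℝ) + t * I)‖) := by gcongr
    _ ≤ (Real.exp (7 * R) * Real.exp (R * √‖((1 : ℝ) + t * I : ℂ)‖)) *
        (Real.exp κ * ‖weight ((1 : ℝ) + t * I)‖) := by
      refine mul_le_mul_of_nonneg_right (mul_le_mul ?_ ?_ (Real.exp_pos _).le
        (Real.exp_pos _).le) (by positivity)
      · exact Real.exp_le_exp.mpr (by linarith)
      · exact Real.exp_le_exp.mpr (mul_le_mul_of_nonneg_right hp1 (Real.sqrt_nonneg _))
    _ = Real.exp (7 * R) * Real.exp κ * (Real.exp (R * √‖((1 : ℝ) + t * I : ℂ)‖) *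
        ‖weight ((1 : ℝ) + t * I)‖) := by ring
    _ ≤ Real.exp (7 * R) * Real.exp κ * (K / (1 + t ^ 2)) :=
      mul_le_mul_of_nonneg_left h1 (by positivity)
    _ = _ := by ring

/-- A superposition of the exponentials `wave`. -/
noncomputable def meanPeriodic (κ : ℝ) (p : ℝ × ℝ) : ℂ :=
  ∫ t : ℝ, wave p ((1 : ℝ) + t * I) * density κ t

theorem continuous_wave_mul_density (κ : ℝ) :
    Continuous fun q : (ℝ × ℝ) × ℝ => wave q.1 ((1 : ℝ) + q.2 * I) * density κ q.2 :=
  continuous_wave_vertical.mul ((continuous_density κ).comp continuous_snd)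

theorem continuous_meanPeriodic (κ : ℝ) : Continuous (meanPeriodic κ) := by
  refine continuous_iff_continuousAt.mpr fun p => ?_
  obtain ⟨K, hK⟩ := exists_norm_wave_mul_density_le κ (‖p‖ + 1)
  refine continuousAt_of_dominated (bound := fun t => K / (1 + t ^ 2))
    (Eventually.of_forall fun q => ?_) ?_ (integrable_const_div_one_add_sq K)
    (Eventually.of_forall fun t => ?_)
  · exact ((continuous_wave_mul_density κ).comp
      (Continuous.prodMk continuous_const continuous_id)).aestronglyMeasurable
  · filter_upwards [Metric.ball_mem_nhds p one_pos] with q hq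
    refine Eventually.of_forall (hK q ?_)
    have := norm_sub_norm_le q p
    have := mem_ball_iff_norm.mp hq
    linarith
  · exact ((continuous_wave_mul_density κ).comp
      (Continuous.prodMk continuous_id continuous_const)).continuousAt

theorem meanPeriodic_zero (κ : ℝ) : meanPeriodic κ 0 =
    ∫ t : ℝ, exp (κ * ((1 : ℝ) + t * I)) * weight ((1 : ℝ) + t * I) := by
  simp [meanPeriodic, wave, density]

theorem integral_meanPeriodic_mul (κ : ℝ) {f : ℝ × ℝ → ℂ} (hf : Continuous f)
    (hc : HasCompactSupport f) (p : ℝ × ℝ) : ∫ s, meanPeriodic κ (p + s) * f s =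
      ∫ t : ℝ, wave p ((1 : ℝ) + t * I) * (∫ s : ℝ × ℝ, f s *
        exp (csqrt ((1 : ℝ) + t * I) * s.1 + gam (csqrt ((1 : ℝ) + t * I)) * s.2)) *
          density κ t := by
  obtain ⟨R, hR⟩ := hc.isCompact.isBounded.exists_norm_le
  obtain ⟨K, hK⟩ := exists_norm_wave_mul_density_le κ (‖p‖ + R)
  have hcont : Continuous fun q : (ℝ × ℝ) × ℝ =>
      wave (p + q.1) ((1 : ℝ) + q.2 * I) * density κ q.2 * f q.1 :=
    ((continuous_wave_mul_density κ).comp (((continuous_const.add continuous_fst)).prodMk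
      continuous_snd)).mul (hf.comp continuous_fst)
  have hint : Integrable (Function.uncurry fun (s : ℝ × ℝ) (t : ℝ) =>
      wave (p + s) ((1 : ℝ) + t * I) * density κ t * f s) (volume.prod volume) := by
    refine Integrable.mono' ((hf.integrable_of_hasCompactSupport hc).norm.mul_prod
      (integrable_const_div_one_add_sq K)) hcont.aestronglyMeasurable
      (Eventually.of_forall fun q => ?_)
    rw [Function.uncurry_def]
    dsimp only
    rw [norm_mul, mul_comm]
    by_cases hq : q.1 ∈ tsupport f
    · refine mul_le_mul_of_nonneg_left (hK _ ?_ _) (norm_nonneg _)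
      exact (norm_add_le _ _).trans (by linarith [hR _ hq])
    · rw [image_eq_zero_of_notMem_tsupport hq]; simp
  simp_rw [meanPeriodic, ← integral_mul_const]
  rw [integral_integral_swap hint]
  refine integral_congr_ae (Eventually.of_forall fun t => ?_)
  dsimp only
  rw [mul_assoc, ← integral_mul_const, ← integral_const_mul]
  refine integral_congr_ae (Eventually.of_forall fun s => ?_)
  dsimp only
  rw [wave_add, wave.eq_def s, mul_comm (s.1 : ℂ), mul_comm (s.2 : ℂ)]
  ring

/-- Coefficients of the symbol `z₂ - gam z₁`. -/
noncomputable def graphCoeff : ℕ → ℂ → ℂ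
  | 0 => fun z => -gam z
  | 1 => fun _ => 1
  | _ => fun _ => 0

theorem isFactorialDecay_graphCoeff : IsFactorialDecay graphCoeff := by
  refine ⟨fun n => ?_, 9, 1, by norm_num, one_pos, fun n z => ?_⟩
  · match n with
    | 0 => exact differentiable_gam.neg
    | 1 => exact differentiable_const _
    | _ + 2 => exact differentiable_const _
  · match n with
    | 0 => simpa [graphCoeff] using norm_gam_le z
    | 1 =>
      have : (1 : ℝ) ≤ Real.exp (‖z‖ ^ (2 / 3 : ℝ)) := Real.one_le_exp (by positivity)
      simp only [graphCoeff, norm_one, Nat.factorial_one, Nat.cast_one, Real.one_rpow, pow_one,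
        div_one, mul_one]
      linarith
    | k + 2 => simp only [graphCoeff, norm_zero]; positivity

theorem tsum_graphCoeff (z₁ z₂ : ℂ) : ∑' n, graphCoeff n z₁ * z₂ ^ n = z₂ - gam z₁ := by
  rw [tsum_eq_sum (s := Finset.range 2) fun n hn => ?_]
  · simp [Finset.sum_range_succ, graphCoeff]; ring
  · match n with
    | 0 => simp at hn
    | 1 => simp at hn
    | _ + 2 => simp [graphCoeff]

theorem IsAiryLike.exists_norm_csqrt_le {Θ : ℂ → ℂ} (hΘ : IsAiryLike Θ) :
    ∃ K : ℝ, 0 < K ∧ ∀ v : ℂ, 0 < v.re → ‖Θ (csqrt v)‖ ≤ K := by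
  obtain ⟨K, hK, h⟩ := hΘ.decay
  refine ⟨K, hK, fun v hv => (h _ ?_).trans (mul_le_of_le_one_right hK.le ?_)⟩
  · have h1 := csqrt_re_sq_sub v
    have h2 := norm_sq_eq_re_sq_add_im_sq (csqrt v)
    refine le_of_pow_le_pow_left₀ (n := 2) two_ne_zero (csqrt_re_pos hv).le ?_
    rw [mul_pow, h2]
    norm_num
    nlinarith [sq_nonneg (csqrt v).im]
  · rw [Real.exp_le_one_iff]
    have : 0 ≤ √‖csqrt v‖ ^ 3 := by positivity
    linarith

theorem integral_wave_mul_eq_zero {Θ : ℂ → ℂ} (hΘ : IsAiryLike Θ) {ε : ℝ} (hε : 0 < ε)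
    (p : ℝ × ℝ) : ∫ t : ℝ, (fun v => wave p v * (bumpLaplace (ε * csqrt v) *
      bumpLaplace (ε * gam (csqrt v))) * Θ (csqrt v) * weight v) ((1 : ℝ) + t * I) = 0 := by
  obtain ⟨C, hC, hB⟩ := exists_norm_bumpLaplace_le
  obtain ⟨L, hL, hbd⟩ := hΘ.exists_norm_csqrt_le
  obtain ⟨K, hK, h⟩ := exists_exp_mul_norm_weight_le (|p.1| + ε)
  refine integral_vertical_eq_zero (a := 1) (f := fun v => wave p v * (bumpLaplace (ε * csqrt v) *
      bumpLaplace (ε * gam (csqrt v))) * Θ (csqrt v) * weight v)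
    (K := Real.exp (7 * |p.2|) * C * (C * Real.exp (ε * 7)) * L * K)
    one_pos (fun v hv => ?_) fun v hv => ?_
  · have hv0 : 0 < v.re := lt_of_lt_of_le one_pos hv
    have h1 := (hasDerivAt_csqrt hv0).differentiableAt
    have h2 : DifferentiableAt ℂ (fun v => gam (csqrt v)) v := (differentiable_gam _).comp v h1
    have h3 : DifferentiableAt ℂ (fun v => bumpLaplace (ε * csqrt v)) v :=
      (differentiable_bumpLaplace _).comp v (h1.const_mul _)
    have h4 : DifferentiableAt ℂ (fun v => bumpLaplace (ε * gam (csqrt v))) v :=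
      (differentiable_bumpLaplace _).comp v (h2.const_mul _)
    have h5 : DifferentiableAt ℂ (fun v => Θ (csqrt v)) v := (hΘ.differentiable _).comp v h1
    have h6 : DifferentiableAt ℂ (wave p) v := ((h1.const_mul _).add (h2.const_mul _)).cexp
    exact (((h6.mul (h3.mul h4)).mul h5).mul (differentiableAt_weight hv0)).differentiableWithinAt
  · have hv0 : 0 < v.re := by linarith
    have h1 := norm_wave_le p hv0
    have h2 : ‖bumpLaplace (ε * csqrt v)‖ ≤ C * Real.exp (ε * √‖v‖) := by
      refine (hB _).trans_eq ?_
      rw [norm_mul, norm_real, Real.norm_of_nonneg hε.le, norm_csqrt]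
    have h3 : ‖bumpLaplace (ε * gam (csqrt v))‖ ≤ C * Real.exp (ε * 7) := by
      refine (hB _).trans (mul_le_mul_of_nonneg_left (Real.exp_le_exp.mpr ?_) hC)
      rw [norm_mul, norm_real, Real.norm_of_nonneg hε.le]
      exact mul_le_mul_of_nonneg_left (norm_gam_csqrt_le hv0) hε.le
    have h4 := h v hv
    simp only [norm_mul]
    calc _ ≤ Real.exp (7 * |p.2|) * Real.exp (|p.1| * √‖v‖) *
          (C * Real.exp (ε * √‖v‖) * (C * Real.exp (ε * 7))) * L * ‖weight v‖ := by
          gcongr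
          exact hbd v hv0
      _ = Real.exp (7 * |p.2|) * C * (C * Real.exp (ε * 7)) * L *
          (Real.exp ((|p.1| + ε) * √‖v‖) * ‖weight v‖) := by
          rw [add_mul, Real.exp_add]; ring
      _ ≤ Real.exp (7 * |p.2|) * C * (C * Real.exp (ε * 7)) * L * (K / (v.re * (1 + v.im ^ 2))) :=
          mul_le_mul_of_nonneg_left h4 (by positivity)
      _ = _ := by ring

theorem exists_pos_bumpLaplace_mul_ne_zero (z₁ z₂ : ℂ) :
    ∃ ε : ℝ, 0 < ε ∧ bumpLaplace (ε * z₁) * bumpLaplace (ε * z₂) ≠ 0 := by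
  have hB := differentiable_bumpLaplace.continuous
  have h1 : Continuous fun ε : ℝ => bumpLaplace (ε * z₁) * bumpLaplace (ε * z₂) :=
    (hB.comp (by fun_prop)).mul (hB.comp (by fun_prop))
  have h2 : ∀ᶠ ε : ℝ in 𝓝 0, bumpLaplace (ε * z₁) * bumpLaplace (ε * z₂) ≠ 0 :=
    h1.continuousAt.eventually_ne (by simp [bumpLaplace_zero_ne_zero])
  have h3 : ∀ᶠ ε : ℝ in 𝓝[>] 0, bumpLaplace (ε * z₁) * bumpLaplace (ε * z₂) ≠ 0 :=
    nhdsWithin_le_nhds h2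
  obtain ⟨ε, hε, hpos⟩ := (h3.and self_mem_nhdsWithin).exists
  exact ⟨ε, hpos, hε⟩

/-- A nonzero continuous function whose annihilator in the test functions has no common zero. -/
theorem exists_continuous_forall_exists_annihilator : ∃ u : ℝ × ℝ → ℂ, Continuous u ∧ u 0 ≠ 0 ∧
    ∀ z₁ z₂ : ℂ, ∃ f : ℝ × ℝ → ℂ, Continuous f ∧ HasCompactSupport f ∧
      (∀ p, ∫ s, u (p + s) * f s = 0) ∧ ∫ s : ℝ × ℝ, f s * exp (z₁ * s.1 + z₂ * s.2) ≠ 0 := by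
  obtain ⟨κ, hκ, h0⟩ := exists_integral_exp_mul_weight_ne_zero
  refine ⟨meanPeriodic κ, continuous_meanPeriodic κ, by rwa [meanPeriodic_zero], fun z₁ z₂ => ?_⟩
  obtain ⟨ε, hε, hB⟩ := exists_pos_bumpLaplace_mul_ne_zero z₁ z₂
  have hε0 : (ε : ℂ) ≠ 0 := by exact_mod_cast hε.ne'
  by_cases hz : z₂ = gam z₁
  · obtain ⟨Θ, hΘ, hne⟩ := exists_isAiryLike_ne_zero z₁
    obtain ⟨f, hf, hc, hF⟩ :=
      (isFactorialDecay_expansionCoeff hκ hΘ).exists_integral_mul_exp_eq hε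
    refine ⟨f, hf, hc, fun p => ?_, ?_⟩
    · rw [integral_meanPeriodic_mul κ hf hc, ← mul_zero ((ε : ℂ) ^ 2),
        ← integral_wave_mul_eq_zero hΘ hε p, ← integral_const_mul]
      refine integral_congr_ae (Eventually.of_forall fun t => ?_)
      dsimp only
      rw [hF, tsum_expansionCoeff hκ hΘ, gaussAiry, density, csqrt_sq, neg_mul, exp_neg]
      field_simp [exp_ne_zero]
    · rw [hF, hz, tsum_expansionCoeff hκ hΘ, ← hz, gaussAiry]
      exact mul_ne_zero (mul_ne_zero (pow_ne_zero _ hε0) hB) (mul_ne_zero (exp_ne_zero _) hne)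
  · obtain ⟨f, hf, hc, hF⟩ := isFactorialDecay_graphCoeff.exists_integral_mul_exp_eq hε
    refine ⟨f, hf, hc, fun p => ?_, ?_⟩
    · rw [integral_meanPeriodic_mul κ hf hc]
      simp [hF, tsum_graphCoeff]
    · rw [hF, tsum_graphCoeff]
      exact mul_ne_zero (mul_ne_zero (pow_ne_zero _ hε0) hB) (sub_ne_zero.mpr hz)

end MeanPeriodic

section Reduction

/-- The rescaling `r ^ n * P (y / r)` of a polynomial of degree `n`, extended to `r = 0`. -/
theorem exists_continuous_rescaling {d : ℕ} {P : MvPolynomial (Fin d) ℂ} (hP : P ≠ 0) :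
    ∃ (n : ℕ) (S : ℝ → (Fin d → ℝ) → ℂ), Continuous S.uncurry ∧
      (∀ r x, S r (r • x) = r ^ n * MvPolynomial.eval (fun i => (x i : ℂ)) P) ∧
      ∃ y, S 0 y ≠ 0 := by
  set n := P.totalDegree with hn
  refine ⟨n, fun r y => ∑ m ∈ P.support, P.coeff m * r ^ (n - ∑ i, m i) *
    ∏ i, (y i : ℂ) ^ m i, ?_, fun r x => ?_, ?_⟩
  · simp only [Function.uncurry_def]
    fun_prop
  · rw [MvPolynomial.eval_eq', Finset.mul_sum]
    refine Finset.sum_congr rfl fun m hm => ?_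
    have h1 : ∑ i, m i ≤ n := by
      have := MvPolynomial.le_totalDegree hm
      rwa [Finsupp.sum_fintype _ _ fun _ => rfl] at this
    simp only [Pi.smul_apply, smul_eq_mul, ofReal_mul, mul_pow, Finset.prod_mul_distrib,
      Finset.prod_pow_eq_pow_sum]
    rw [← pow_sub_mul_pow (r : ℂ) h1]
    ring
  · by_contra! h
    have h0 : MvPolynomial.homogeneousComponent n P = 0 := by
      refine MvPolynomial.funext_set (fun _ => range ((↑) : ℝ → ℂ))
        (fun _ => infinite_range_of_injective ofReal_injective) fun x hx => ?_
      choose y hy using fun i => hx i (mem_univ i)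
      obtain rfl : (fun i => (y i : ℂ)) = x := funext hy
      rw [map_zero, ← h y, MvPolynomial.homogeneousComponent_apply, map_sum, Finset.sum_filter]
      refine Finset.sum_congr rfl fun m hm => ?_
      have h1 : ∑ i, m i ≤ n := by
        have := MvPolynomial.le_totalDegree hm
        rwa [Finsupp.sum_fintype _ _ fun _ => rfl] at this
      rw [Finsupp.degree_eq_sum]
      split_ifs with h2
      · simp [MvPolynomial.eval_monomial, Finsupp.prod_fintype, h2]
      · simp [Nat.sub_ne_zero_of_lt (lt_of_le_of_ne h1 h2)]
    obtain ⟨m, hm, hmn⟩ := P.support.exists_mem_eq_sup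
      (MvPolynomial.support_nonempty.mpr hP) fun s => s.sum fun _ e => e
    have h2 := congrArg (MvPolynomial.coeff m) h0
    rw [MvPolynomial.coeff_homogeneousComponent, if_pos, MvPolynomial.coeff_zero] at h2
    · exact MvPolynomial.mem_support_iff.mp hm h2
    · rw [hn, MvPolynomial.totalDegree, hmn]
      rfl

theorem eq_zero_of_forall_integral_exp_monomial_eq_zero {d : ℕ} {ι : ℝ × ℝ → Fin d → ℝ}
    (hι : Continuous ι) {f : ℝ × ℝ → ℂ} (hf : Continuous f) (hfc : HasCompactSupport f)
    {P : MvPolynomial (Fin d) ℂ} {l : Fin d → ℂ}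
    (h : ∀ g : Fin d → ℝ, ∫ s, MvPolynomial.eval (fun i => ((g + ι s) i : ℂ)) P *
      exp (∑ i, l i * (g + ι s) i) * f s = 0)
    (hne : ∫ s, exp (∑ i, l i * ι s i) * f s ≠ 0) : P = 0 := by
  by_contra hP
  obtain ⟨n, S, hS, hSr, y, hy⟩ := exists_continuous_rescaling hP
  let J : ℝ → ℂ := fun r => ∫ s, S r (y + r • ι s) * (exp (∑ i, l i * ι s i) * f s)
  have hJ : Continuous J := by
    rw [← continuousOn_univ]
    refine continuousOn_integral_of_compact_support hfc (Continuous.continuousOn ?_)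
      fun r s _ hs => by simp [image_eq_zero_of_notMem_tsupport hs]
    have h1 : Continuous fun q : ℝ × (ℝ × ℝ) => S q.1 (y + q.1 • ι q.2) :=
      hS.comp (f := fun q : ℝ × (ℝ × ℝ) => (q.1, y + q.1 • ι q.2)) (by fun_prop)
    simp only [Function.uncurry_def]
    fun_prop
  have hJ0 : J = fun _ => 0 := by
    refine hJ.ext_on (dense_compl_singleton (0 : ℝ)) continuous_const fun r hr => ?_
    have hr : r ≠ 0 := hr
    have h1 : ∀ s, S r (y + r • ι s) * (exp (∑ i, l i * ι s i) * f s) =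
        r ^ n * exp (-∑ i, l i * (r⁻¹ • y) i) *
          (MvPolynomial.eval (fun i => ((r⁻¹ • y + ι s) i : ℂ)) P *
            exp (∑ i, l i * (r⁻¹ • y + ι s) i) * f s) := fun s => by
      have h2 : y + r • ι s = r • (r⁻¹ • y + ι s) := by rw [smul_add, smul_inv_smul₀ hr]
      have h3 : exp (∑ i, l i * ι s i) = exp (-∑ i, l i * (r⁻¹ • y) i) *
          exp (∑ i, l i * (r⁻¹ • y + ι s) i) := by
        rw [← Complex.exp_add]
        simp [mul_add, Finset.sum_add_distrib]
      rw [h2, hSr, h3]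
      ring
    change ∫ s, S r (y + r • ι s) * (exp (∑ i, l i * ι s i) * f s) = 0
    simp_rw [h1]
    rw [integral_const_mul, h, mul_zero]
  have h0 : J 0 = S 0 y * ∫ s, exp (∑ i, l i * ι s i) * f s := by
    simp only [J, zero_smul, add_zero, integral_const_mul]
  rw [hJ0] at h0
  exact mul_ne_zero hy hne h0.symm

/-- The continuous functions `φ` such that `∫ s, φ (g + ι s) * f s = 0` for all `f ∈ F` and all
`g`. -/
def annihilated {E : Type*} [NormedAddCommGroup E] {ι : ℝ × ℝ → E} (hι : Continuous ι)
    (F : Set (ℝ × ℝ → ℂ)) (hF : ∀ f ∈ F, Continuous f ∧ HasCompactSupport f) :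
    Submodule ℂ C(E, ℂ) where
  carrier := {φ | ∀ f ∈ F, ∀ g, ∫ s, φ (g + ι s) * f s = 0}
  zero_mem' f _ g := by simp
  add_mem' {φ ψ} hφ hψ f hf g := by
    have hint : ∀ χ : C(E, ℂ), Integrable fun s => χ (g + ι s) * f s := fun χ =>
      have := (hF f hf).1
      Continuous.integrable_of_hasCompactSupport (by fun_prop) (hF f hf).2.mul_left
    simp only [ContinuousMap.add_apply, add_mul]
    rw [integral_add (hint φ) (hint ψ), hφ f hf g, hψ f hf g, add_zero]
  smul_mem' c φ hφ f hf g := by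
    simp only [ContinuousMap.smul_apply, smul_eq_mul, mul_assoc]
    rw [integral_const_mul, hφ f hf g, mul_zero]

theorem isClosed_annihilated {E : Type*} [NormedAddCommGroup E] [LocallyCompactSpace E]
    {ι : ℝ × ℝ → E} (hι : Continuous ι) (F : Set (ℝ × ℝ → ℂ))
    (hF : ∀ f ∈ F, Continuous f ∧ HasCompactSupport f) :
    IsClosed (annihilated hι F hF : Set C(E, ℂ)) := by
  have h : (annihilated hι F hF : Set C(E, ℂ)) =
      ⋂ f ∈ F, ⋂ g : E, {φ : C(E, ℂ) | ∫ s, φ (g + ι s) * f s = 0} := by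
    ext φ
    simp [annihilated]
  rw [h]
  refine isClosed_biInter fun f hf => isClosed_iInter fun g => isClosed_eq ?_ continuous_const
  rw [← continuousOn_univ]
  refine continuousOn_integral_of_compact_support (hF f hf).2 (Continuous.continuousOn ?_)
    fun φ s _ hs => by simp [image_eq_zero_of_notMem_tsupport hs]
  have := (hF f hf).1
  simp only [Function.uncurry_def]
  have h1 : Continuous fun q : C(E, ℂ) × (ℝ × ℝ) => q.1 (g + ι q.2) :=
    continuous_eval.comp (f := fun q : C(E, ℂ) × (ℝ × ℝ) => (q.1, g + ι q.2)) (by fun_prop)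
  fun_prop

theorem comp_addRight_mem_annihilated {E : Type*} [NormedAddCommGroup E]
    {ι : ℝ × ℝ → E} {hι : Continuous ι} {F : Set (ℝ × ℝ → ℂ)}
    {hF : ∀ f ∈ F, Continuous f ∧ HasCompactSupport f} {φ : C(E, ℂ)}
    (hφ : φ ∈ annihilated hι F hF) (g : E) :
    φ.comp (Homeomorph.addRight g) ∈ annihilated hι F hF := fun f hf g' => by
  simpa [add_right_comm] using hφ f hf (g' + g)

end Reduction

end Gurevich

/-- Gurevich: for every `d ≥ 2` there is a translation-invariant
closed subspace of `C(ℝᵈ,ℂ)` (compact-open topology) in which the span of the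
exponential monomials `x ↦ P(x)·exp(λ₁x₁+⋯+λ_dx_d)` belonging to it is not
dense. -/
theorem gurevich_no_spectral_synthesis_on_Rd (d : ℕ) (hd : 2 ≤ d) :
    ∃ V : Submodule ℂ C((Fin d → ℝ), ℂ),
      IsClosed (V : Set C((Fin d → ℝ), ℂ)) ∧
      (∀ h ∈ V, ∀ g : Fin d → ℝ, h.comp (Homeomorph.addRight g) ∈ V) ∧
      ¬ ((V : Set C((Fin d → ℝ), ℂ)) ⊆
        closure (Submodule.span ℂ
          {h : C((Fin d → ℝ), ℂ) | h ∈ V ∧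
            ∃ (P : MvPolynomial (Fin d) ℂ) (l : Fin d → ℂ),
              ∀ x : Fin d → ℝ,
                h x = (MvPolynomial.eval fun i => (x i : ℂ)) P *
                  Complex.exp (∑ i, l i * x i)} : Set C((Fin d → ℝ), ℂ))) := by
  obtain ⟨u, hu, hu0, H⟩ := Gurevich.exists_continuous_forall_exists_annihilator
  obtain ⟨k, rfl⟩ : ∃ k, d = k + 2 := ⟨d - 2, by omega⟩
  let ι : ℝ × ℝ → Fin (k + 2) → ℝ := fun s => Fin.cons s.1 (Fin.cons s.2 0)
  have hι : Continuous ι := by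
    refine continuous_pi fun i => ?_
    induction i using Fin.cases with
    | zero => exact continuous_fst
    | succ i =>
      induction i using Fin.cases with
      | zero => exact continuous_snd
      | succ i => exact continuous_const
  let F : Set (ℝ × ℝ → ℂ) :=
    {f | (Continuous f ∧ HasCompactSupport f) ∧ ∀ p, ∫ s, u (p + s) * f s = 0}
  let V := Gurevich.annihilated hι F fun f hf => hf.1
  let φ : C(Fin (k + 2) → ℝ, ℂ) := ⟨fun x => u (x 0, x 1), by fun_prop⟩
  have hφ : φ ∈ V := fun f hf g => hf.2 (g 0, g 1)
  refine ⟨V, Gurevich.isClosed_annihilated hι F _,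
    fun h hh g => Gurevich.comp_addRight_mem_annihilated hh g, fun hV => hu0 ?_⟩
  have hzero : Submodule.span ℂ {h : C((Fin (k + 2) → ℝ), ℂ) | h ∈ V ∧
      ∃ (P : MvPolynomial (Fin (k + 2)) ℂ) (l : Fin (k + 2) → ℂ), ∀ x : Fin (k + 2) → ℝ,
        h x = (MvPolynomial.eval fun i => (x i : ℂ)) P * Complex.exp (∑ i, l i * x i)} = ⊥ := by
    rw [Submodule.span_eq_bot]
    rintro h ⟨hhV, P, l, hP⟩
    obtain ⟨f, hf, hfc, hfu, hfe⟩ := H (l 0) (l 1)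
    have hP0 : P = 0 := by
      refine Gurevich.eq_zero_of_forall_integral_exp_monomial_eq_zero hι hf hfc (l := l)
        (fun g => ?_) ?_
      · simpa only [hP] using hhV f ⟨⟨hf, hfc⟩, hfu⟩ g
      · convert hfe using 3 with s
        simp [ι, Fin.sum_univ_succ, mul_comm]
    ext x
    simp [hP, hP0]
  have h := hV hφ
  rw [hzero, Submodule.bot_coe, closure_singleton, Set.mem_singleton_iff] at h
  exact congrArg (fun ψ : C(Fin (k + 2) → ℝ, ℂ) => ψ 0) h
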